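/- Let f(x) ∈ ℚ(x) be a rational function of degree at least 2, let α ∈ ℚ be a wandering point for f, and let β ∈ ℚ be a preperiodic point for f, where f is regarded as a self-map of P¹(ℚ). Assume further that for every k ≥ 1, the equation f^k(x) = β has at least one complex solution other than x = β. For each n ≥ 1 with f^n(α) ∈ ℚ, let a_n ∈ ℤ be the numerator of f^n(α) − β written in lowest terms. Then the Zsigmondy set of the sequence (a_n) is finite: for all but finitely many n with a_n ≠ 0, there exists a prime p dividing a_n that does not divide a_k for any k < n with a_k ≠ 0. -/

import Mathlib

attribute [local instance] Classical.propDecidable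

/-- The self-map of P¹(K) = K ∪ {∞} (modelled as `Option K`, with `none` = ∞) induced by a
rational function f = num/denom. -/
noncomputable def P1map {K : Type*} [Field K] (f : RatFunc K) : Option K → Option K
  | some x =>
      if f.denom.eval x = 0 then none else some (f.num.eval x / f.denom.eval x)
  | none =>
      if f.denom.natDegree < f.num.natDegree then none
      else if f.num.natDegree < f.denom.natDegree then some 0
      else some (f.num.leadingCoeff / f.denom.leadingCoeff)

/-- Base change of a rational function from ℚ(X) to ℂ(X). -/
noncomputable def ratFuncQC (f : RatFunc ℚ) : RatFunc ℂ :=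
  algebraMap (Polynomial ℂ) (RatFunc ℂ) (f.num.map (algebraMap ℚ ℂ)) /
    algebraMap (Polynomial ℂ) (RatFunc ℂ) (f.denom.map (algebraMap ℚ ℂ))

/-- The integer a_n: the numerator of f^n(α) − β in lowest terms, with junk value 0 when
f^n(α) = ∞. -/
noncomputable def numSeq (f : RatFunc ℚ) (α β : ℚ) (n : ℕ) : ℤ :=
  ((P1map f)^[n] (some α)).elim 0 (fun x => (x - β).num)

theorem absoluteValue_intCast_le (v : AbsoluteValue ℚ ℝ) (m : ℤ) : v (m : ℚ) ≤ |(m : ℝ)| := by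
  have key : ∀ k : ℕ, v (k : ℚ) ≤ k := by
    intro k
    induction k with
    | zero => simp
    | succ k ih =>
      push_cast
      calc v ((k : ℚ) + 1) ≤ v (k : ℚ) + v 1 := v.add_le _ _
        _ ≤ k + 1 := by rw [v.map_one]; linarith
  rcases Int.eq_nat_or_neg m with ⟨k, rfl | rfl⟩
  · simpa using key k
  · simpa using key k

open Polynomial in
/-- Powers of `X` modulo a monic integer polynomial: remainders and quotients grow at most
exponentially, the latter at every absolute value. -/
theorem exists_pow_eq_mul_add (g : ℤ[X]) (hg : g.Monic) (hr : 1 ≤ g.natDegree) :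
    ∃ C : ℕ, 1 ≤ C ∧ ∀ k : ℕ, ∃ q r : ℤ[X], X ^ k = g * q + r ∧ r.natDegree < g.natDegree ∧
      (∀ i, |r.coeff i| ≤ (C : ℤ) ^ k) ∧
      ∀ (v : AbsoluteValue ℚ ℝ) (y : ℚ), v (aeval y q) ≤ (2 * C * max 1 (v y)) ^ k := by
  set M : ℕ := ∑ i ∈ Finset.range (g.natDegree + 1), (g.coeff i).natAbs with hM
  have hgc : ∀ i, |g.coeff i| ≤ (M : ℤ) := by
    intro i
    by_cases hi : i ∈ Finset.range (g.natDegree + 1)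
    · rw [Int.abs_eq_natAbs]
      exact_mod_cast Finset.single_le_sum (f := fun i => (g.coeff i).natAbs)
        (fun _ _ => Nat.zero_le _) hi
    · rw [coeff_eq_zero_of_natDegree_lt (by simpa using hi)]
      simp
  refine ⟨1 + M, by omega, fun k => ?_⟩
  induction k with
  | zero =>
    refine ⟨0, 1, by simp, by rw [natDegree_one]; exact hr, fun i => ?_, fun v y => by simp⟩
    rw [coeff_one]
    split_ifs <;> simp
  | succ k ih =>
    obtain ⟨q, r, hqr, hdeg, hc, hv⟩ := ih
    set s := r.coeff (g.natDegree - 1) with hs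
    refine ⟨X * q + C s, X * r - C s * g, ?_, ?_, ?_, ?_⟩
    · rw [pow_succ, hqr]; ring
    · have h1 : (X * r - C s * g).natDegree ≤ g.natDegree := by
        refine (natDegree_sub_le _ _).trans (max_le ?_ (natDegree_C_mul_le _ _))
        refine natDegree_mul_le.trans ?_
        have := natDegree_X_le (R := ℤ)
        omega
      refine lt_of_le_of_ne h1 fun h2 => ?_
      have h3 : (X * r - C s * g).coeff g.natDegree = 0 := by
        obtain ⟨t, ht⟩ : ∃ t, g.natDegree = t + 1 := ⟨g.natDegree - 1, by omega⟩
        have hl : g.coeff g.natDegree = 1 := hg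
        rw [coeff_sub, coeff_C_mul, hl, hs, ht, coeff_X_mul]
        simp
      rw [← h2] at h3
      have h4 : X * r - C s * g = 0 := leadingCoeff_eq_zero.mp h3
      rw [h4] at h2
      simp at h2
      omega
    · intro i
      have h1 : |(X * r).coeff i| ≤ ((1 + M : ℕ) : ℤ) ^ k := by
        cases i with
        | zero => rw [coeff_X_mul_zero, abs_zero]; positivity
        | succ i => rw [coeff_X_mul]; exact hc i
      have h2 : |s * g.coeff i| ≤ ((1 + M : ℕ) : ℤ) ^ k * M := by
        rw [abs_mul]
        exact mul_le_mul (hc _) (hgc i) (abs_nonneg _) (by positivity)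
      rw [coeff_sub, coeff_C_mul]
      calc _ ≤ |(X * r).coeff i| + |s * g.coeff i| := abs_sub _ _
        _ ≤ ((1 + M : ℕ) : ℤ) ^ k + ((1 + M : ℕ) : ℤ) ^ k * M := add_le_add h1 h2
        _ = _ := by push_cast; ring
    · intro v y
      have hm : 1 ≤ max 1 (v y) := le_max_left _ _
      have hs' : v ((s : ℤ) : ℚ) ≤ ((1 + M : ℕ) : ℝ) ^ k := by
        refine (absoluteValue_intCast_le v s).trans ?_
        exact_mod_cast hc _
      have hC : (1 : ℝ) ≤ ((1 + M : ℕ) : ℝ) := by push_cast; linarith [Nat.cast_nonneg (α := ℝ) M]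
      set c : ℝ := ((1 + M : ℕ) : ℝ)
      set m := max 1 (v y) with hmdef
      have h5 : v (y * aeval y q) ≤ m * (2 * c * m) ^ k := by
        rw [v.map_mul]
        exact mul_le_mul (le_max_right _ _) (hv v y) (v.nonneg _) (by positivity)
      have h6 : c ^ k ≤ (2 * c * m) ^ k := by
        gcongr
        nlinarith
      have h7 : aeval y (X * q + C s) = y * aeval y q + (s : ℚ) := by simp
      rw [h7]
      calc _ ≤ v (y * aeval y q) + v (s : ℚ) := v.add_le _ _
        _ ≤ m * (2 * c * m) ^ k + (2 * c * m) ^ k := add_le_add h5 (hs'.trans h6)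
        _ ≤ (2 * c * m) ^ (k + 1) := by
          rw [pow_succ]
          have : (0 : ℝ) ≤ (2 * c * m) ^ k := by positivity
          have h8 : m + 1 ≤ 2 * c * m := by nlinarith
          linarith [mul_le_mul_of_nonneg_left h8 this]

open Polynomial in
/-- Thue's auxiliary pair: `F (X) - Y G (X)` vanishes to order `n` along the diagonal points
given by the roots of `g`. -/
theorem exists_auxiliary_pair (g : ℤ[X]) (hg : g.Monic) (hr : 8 ≤ g.natDegree) :
    ∃ c : ℝ, 1 ≤ c ∧ ∀ n : ℕ, 1 ≤ n → ∃ F G : ℤ[X],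
      F.natDegree ≤ (g.natDegree - 2) * n ∧ G.natDegree ≤ (g.natDegree - 2) * n ∧
      (F ≠ 0 ∨ G ≠ 0) ∧ (∀ i, |(F.coeff i : ℝ)| ≤ c ^ n) ∧ (∀ i, |(G.coeff i : ℝ)| ≤ c ^ n) ∧
      ∀ i < n, ∃ Q : ℤ[X], hasseDeriv i F - X * hasseDeriv i G = g * Q ∧
        ∀ (v : AbsoluteValue ℚ ℝ) (y : ℚ),
          v (aeval y Q) ≤ (c * max 1 (v y) ^ g.natDegree) ^ n := by
  obtain ⟨C₀, hC₀, hqr⟩ := exists_pow_eq_mul_add g hg (by omega)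
  choose q rr hX hrdeg hrc hqv using hqr
  set r := g.natDegree with hrdef
  set c₀ : ℝ := (4 * C₀ : ℝ) ^ (2 * r) with hc₀
  have hC₀' : (1 : ℝ) ≤ C₀ := by exact_mod_cast hC₀
  have hc₀1 : 1 ≤ c₀ := one_le_pow₀ (by linarith)
  have h8 : (1 : ℝ) ≤ (8 * C₀) ^ r := one_le_pow₀ (by linarith)
  refine ⟨c₀ * (8 * C₀) ^ r, by nlinarith, fun n hn => ?_⟩
  set N := (r - 2) * n with hN
  have hNr : N + 2 * n = r * n := by
    rw [hN, ← add_mul]; congr 1; omega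
  have hNn : N + 1 ≤ r * n := by omega
  have hr8 : 8 * n ≤ r * n := Nat.mul_le_mul_right _ hr
  have h2N : 2 * (N + 1) ≤ 2 ^ (N + 1) := by
    have : ∀ k : ℕ, 2 * (k + 1) ≤ 2 ^ (k + 1) := by
      intro k
      induction k with
      | zero => simp
      | succ k ih => rw [pow_succ]; omega
    exact this N
  let A : Matrix (Fin n × Fin r) (Fin (N + 1) ⊕ Fin (N + 1)) ℤ := fun il k =>
    Sum.elim (fun k : Fin (N + 1) => ((k : ℕ).choose il.1 : ℤ) * (rr (k - il.1)).coeff il.2)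
      (fun k : Fin (N + 1) => -(((k : ℕ).choose il.1 : ℤ) * (rr (k - il.1 + 1)).coeff il.2)) k
  have hchoose : ∀ (k : Fin (N + 1)) (i : ℕ), (((k : ℕ).choose i : ℕ) : ℝ) ≤ 2 ^ (N + 1) := by
    intro k i
    have h1 : (k : ℕ).choose i ≤ 2 ^ (k : ℕ) := Nat.choose_le_two_pow _ _
    have h2 : 2 ^ (k : ℕ) ≤ 2 ^ (N + 1) := Nat.pow_le_pow_right (by norm_num) (by omega)
    exact_mod_cast h1.trans h2
  have hcoef : ∀ (j l : ℕ), j ≤ N + 1 → |((rr j).coeff l : ℝ)| ≤ (C₀ : ℝ) ^ (N + 1) := by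
    intro j l hj
    have h1 : |((rr j).coeff l : ℝ)| ≤ (C₀ : ℝ) ^ j := by exact_mod_cast hrc j l
    exact h1.trans (pow_le_pow_right₀ hC₀' hj)
  have hAent : ∀ il k, ‖A il k‖ ≤ (2 * C₀ : ℝ) ^ (N + 1) := by
    intro il k
    rw [mul_pow]
    rcases k with k | k
    · simp only [A, Sum.elim_inl, norm_mul, Int.norm_eq_abs, Int.cast_natCast]
      rw [abs_of_nonneg (Nat.cast_nonneg _)]
      exact mul_le_mul (hchoose _ _) (hcoef _ _ (by omega)) (abs_nonneg _) (by positivity)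
    · simp only [A, Sum.elim_inr, norm_neg, norm_mul, Int.norm_eq_abs, Int.cast_natCast]
      rw [abs_of_nonneg (Nat.cast_nonneg _)]
      exact mul_le_mul (hchoose _ _) (hcoef _ _ (by omega)) (abs_nonneg _) (by positivity)
  have hcardα : Fintype.card (Fin n × Fin r) = n * r := by simp
  have hcardβ : Fintype.card (Fin (N + 1) ⊕ Fin (N + 1)) = 2 * (N + 1) := by
    simp; ring
  obtain ⟨t, ht0, hAt, htn⟩ := Int.Matrix.exists_ne_zero_int_vec_norm_le A
    (by rw [hcardα, hcardβ, mul_comm n r]; omega)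
    (by rw [hcardα]; exact Nat.mul_pos hn (by omega))
  have htb : ∀ k, |(t k : ℝ)| ≤ c₀ ^ n := by
    intro k
    refine (show |(t k : ℝ)| ≤ ‖t‖ from by
      rw [← Int.norm_eq_abs]; exact norm_le_pi_norm t k).trans (htn.trans ?_)
    have hAn := (Matrix.norm_le_iff (A := A) (r := (2 * C₀ : ℝ) ^ (N + 1)) (by positivity)).mpr hAent
    have hmax := max_le (one_le_pow₀ (n := N + 1) (by linarith : (1 : ℝ) ≤ 2 * C₀)) hAn
    have hbase : ((Fintype.card (Fin (N + 1) ⊕ Fin (N + 1)) : ℕ) : ℝ) ≤ 2 ^ (N + 1) := by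
      rw [hcardβ]; exact_mod_cast h2N
    have hprod := mul_le_mul hbase hmax (le_trans zero_le_one (le_max_left _ _)) (by positivity)
    have he1 : (2 : ℝ) ^ (N + 1) * (2 * C₀ : ℝ) ^ (N + 1) = (4 * C₀) ^ (N + 1) := by
      rw [← mul_pow]; ring
    rw [he1] at hprod
    have hnum : (r : ℝ) * n = N + 2 * n := by exact_mod_cast hNr.symm
    have hr8' : (8 : ℝ) * n ≤ r * n := by exact_mod_cast hr8
    have hn' : (1 : ℝ) ≤ n := by exact_mod_cast hn
    rw [hcardα, hcardβ] at *
    have hexp : ((n * r : ℕ) : ℝ) / (((2 * (N + 1) : ℕ) : ℝ) - ((n * r : ℕ) : ℝ)) ≤ (2 : ℕ) := by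
      push_cast
      rw [div_le_iff₀ (by nlinarith)]
      nlinarith
    refine (Real.rpow_le_rpow (mul_nonneg (Nat.cast_nonneg _)
      (le_trans zero_le_one (le_max_left _ _))) hprod ?_).trans ?_
    · push_cast
      refine div_nonneg (by positivity) (by nlinarith)
    refine (Real.rpow_le_rpow_of_exponent_le (one_le_pow₀ (by linarith)) hexp).trans ?_
    rw [Real.rpow_natCast, ← pow_mul, hc₀, ← pow_mul]
    refine pow_le_pow_right₀ (by linarith) ?_
    rw [mul_assoc]; omega
  let F : ℤ[X] := ∑ k : Fin (N + 1), monomial k (t (Sum.inl k))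
  let G : ℤ[X] := ∑ k : Fin (N + 1), monomial k (t (Sum.inr k))
  have hcf : ∀ (s : Fin (N + 1) → ℤ) (i : ℕ), (∑ k : Fin (N + 1), monomial (k : ℕ) (s k)).coeff i
      = if h : i < N + 1 then s ⟨i, h⟩ else 0 := by
    intro s i
    rw [finsetSum_coeff]
    simp only [coeff_monomial]
    split_ifs with h
    · rw [Finset.sum_eq_single ⟨i, h⟩]
      · simp
      · intro b _ hb
        rw [if_neg]
        intro hh
        exact hb (Fin.ext hh)
      · simp
    · refine Finset.sum_eq_zero fun b _ => if_neg ?_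
      have := b.2
      omega
  have hcle : (c₀ : ℝ) ^ n ≤ (c₀ * (8 * C₀) ^ r) ^ n := by
    gcongr
    nlinarith
  have hcb : ∀ (s : Fin (N + 1) → ℤ), (∀ k, |(s k : ℝ)| ≤ c₀ ^ n) → ∀ i,
      |(((∑ k : Fin (N + 1), monomial (k : ℕ) (s k)).coeff i : ℤ) : ℝ)|
        ≤ (c₀ * (8 * C₀) ^ r) ^ n := by
    intro s hs i
    rw [hcf]
    split_ifs
    · exact (hs _).trans hcle
    · simp only [Int.cast_zero, abs_zero]; positivity
  have hdegb : ∀ (s : Fin (N + 1) → ℤ),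
      (∑ k : Fin (N + 1), monomial (k : ℕ) (s k)).natDegree ≤ N := by
    intro s
    rw [natDegree_le_iff_coeff_eq_zero]
    intro i hi
    rw [hcf, dif_neg (by omega)]
  refine ⟨F, G, hdegb _, hdegb _, ?_, hcb _ fun k => htb _, hcb _ fun k => htb _, ?_⟩
  · by_contra hcon
    push Not at hcon
    apply ht0
    funext k
    rcases k with k | k
    · have := hcf (fun k => t (Sum.inl k)) k
      rw [show (∑ k : Fin (N + 1), monomial (k : ℕ) (t (Sum.inl k))) = 0 from hcon.1] at this
      rw [dif_pos k.2] at this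
      exact this.symm
    · have := hcf (fun k => t (Sum.inr k)) k
      rw [show (∑ k : Fin (N + 1), monomial (k : ℕ) (t (Sum.inr k))) = 0 from hcon.2] at this
      rw [dif_pos k.2] at this
      exact this.symm
  · intro i hi
    have hexpand : hasseDeriv i F - X * hasseDeriv i G
        = ∑ k : Fin (N + 1), C (((k : ℕ).choose i : ℤ) * t (Sum.inl k)) * X ^ ((k : ℕ) - i)
          - ∑ k : Fin (N + 1), C (((k : ℕ).choose i : ℤ) * t (Sum.inr k)) * X ^ ((k : ℕ) - i + 1) := by
      simp only [F, G, map_sum, hasseDeriv_monomial, Finset.mul_sum, C_mul_X_pow_eq_monomial,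
        X_mul_monomial]
    let Q : ℤ[X] := ∑ k : Fin (N + 1), C (((k : ℕ).choose i : ℤ) * t (Sum.inl k)) * q ((k : ℕ) - i)
          - ∑ k : Fin (N + 1), C (((k : ℕ).choose i : ℤ) * t (Sum.inr k)) * q ((k : ℕ) - i + 1)
    let R : ℤ[X] := ∑ k : Fin (N + 1), C (((k : ℕ).choose i : ℤ) * t (Sum.inl k)) * rr ((k : ℕ) - i)
          - ∑ k : Fin (N + 1), C (((k : ℕ).choose i : ℤ) * t (Sum.inr k)) * rr ((k : ℕ) - i + 1)
    have hR : R = 0 := by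
      ext l
      by_cases hl : l < r
      · have h1 := congrFun hAt (⟨i, hi⟩, ⟨l, hl⟩)
        simp only [Matrix.mulVec, dotProduct, Fintype.sum_sum_type, A, Sum.elim_inl, Sum.elim_inr,
          Pi.zero_apply] at h1
        simp only [R, coeff_sub, finsetSum_coeff, coeff_C_mul, coeff_zero]
        rw [← h1, sub_eq_add_neg, ← Finset.sum_neg_distrib]
        congr 1 <;> refine Finset.sum_congr rfl fun k _ => by ring
      · simp only [R, coeff_sub, finsetSum_coeff, coeff_C_mul, coeff_zero]
        have hz : ∀ j, (rr j).coeff l = 0 := fun j =>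
          coeff_eq_zero_of_natDegree_lt (lt_of_lt_of_le (hrdeg j) (by omega))
        simp [hz]
    refine ⟨Q, ?_, fun v y => ?_⟩
    · have : g * Q = g * Q + R := by rw [hR, add_zero]
      rw [this, hexpand]
      simp only [Q, R, hX, mul_sub, Finset.mul_sum, mul_add, Finset.sum_add_distrib]
      have hcomm : ∀ a b : ℤ[X], a * (g * b) = g * (a * b) := fun a b => by ring
      simp only [hcomm]
      ring
    · set m := max 1 (v y) with hm
      have hm1 : 1 ≤ m := le_max_left _ _
      have hbase : 1 ≤ 2 * C₀ * m := by nlinarith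
      have hterm : ∀ (k : Fin (N + 1)) (a : ℤ) (j : ℕ), |(a : ℝ)| ≤ c₀ ^ n → j ≤ N + 1 →
          v (aeval y (C (((k : ℕ).choose i : ℤ) * a) * q j))
            ≤ 2 ^ (N + 1) * c₀ ^ n * (2 * C₀ * m) ^ (N + 1) := by
        intro k a j ha hj
        have e1 : aeval y (C (((k : ℕ).choose i : ℤ) * a) * q j)
            = ((((k : ℕ).choose i : ℤ) * a : ℤ) : ℚ) * aeval y (q j) := by simp
        rw [e1, v.map_mul]
        refine mul_le_mul ((absoluteValue_intCast_le v _).trans ?_)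
          ((hqv j v y).trans (pow_le_pow_right₀ hbase hj)) (v.nonneg _) (by positivity)
        push_cast
        rw [abs_mul, abs_of_nonneg (Nat.cast_nonneg _)]
        exact mul_le_mul (hchoose _ _) ha (abs_nonneg _) (by positivity)
      have hsum : ∀ w : Fin (N + 1) → ℚ, (∀ k, v (w k) ≤ 2 ^ (N + 1) * c₀ ^ n * (2 * C₀ * m) ^ (N + 1)) →
          v (∑ k, w k) ≤ (N + 1) * (2 ^ (N + 1) * c₀ ^ n * (2 * C₀ * m) ^ (N + 1)) := by
        intro w hw
        refine (v.sum_le _ _).trans ((Finset.sum_le_card_nsmul _ _ _ fun k _ => hw k).trans ?_)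
        simp
      have e2 : aeval y Q = (∑ k : Fin (N + 1), aeval y (C (((k : ℕ).choose i : ℤ) * t (Sum.inl k)) * q ((k : ℕ) - i)))
          - ∑ k : Fin (N + 1), aeval y (C (((k : ℕ).choose i : ℤ) * t (Sum.inr k)) * q ((k : ℕ) - i + 1)) := by
        simp only [Q, map_sub, map_sum]
      rw [e2]
      refine (v.sub_le_add _ _).trans ((add_le_add (hsum _ fun k => hterm k _ _ (htb _) (by omega))
        (hsum _ fun k => hterm k _ _ (htb _) (by omega))).trans ?_)
      have h2N' : (2 : ℝ) * (N + 1) ≤ 2 ^ (N + 1) := by exact_mod_cast h2N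
      calc _ = (2 * ((N : ℝ) + 1)) * (2 ^ (N + 1) * c₀ ^ n * (2 * C₀ * m) ^ (N + 1)) := by ring
        _ ≤ 2 ^ (N + 1) * (2 ^ (N + 1) * c₀ ^ n * (2 * C₀ * m) ^ (N + 1)) := by gcongr
        _ = c₀ ^ n * (8 * C₀ * m) ^ (N + 1) := by
          rw [show (8 * C₀ * m : ℝ) = 2 * (2 * (2 * C₀ * m)) by ring, mul_pow 2, mul_pow 2]; ring
        _ ≤ c₀ ^ n * (8 * C₀ * m) ^ (r * n) := by
          gcongr
          nlinarith
        _ = _ := by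
          rw [pow_mul, ← mul_pow, mul_pow (8 * (C₀ : ℝ)) m r]; ring

open Polynomial in
theorem hasseDeriv_map_ringHom {R S : Type*} [CommRing R] [CommRing S] (φ : R →+* S) (i : ℕ)
    (p : R[X]) : hasseDeriv i (p.map φ) = (hasseDeriv i p).map φ := by
  ext k
  simp [hasseDeriv_coeff]

open Polynomial in
theorem X_sub_C_pow_dvd_of_hasseDeriv_eval {R : Type*} [CommRing R] {p : R[X]} {t : R} {n : ℕ}
    (h : ∀ i < n, (hasseDeriv i p).eval t = 0) : (X - C t) ^ n ∣ p := by
  rw [X_sub_C_pow_dvd_iff, X_pow_dvd_iff]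
  intro i hi
  have := taylor_coeff t p i
  rw [taylor_apply] at this
  rw [this, h i hi]

open Polynomial in
theorem exists_common_factor_of_wronskian_eq_zero {K : Type*} [Field K] [CharZero K] {F G : K[X]}
    (h : wronskian F G = 0) (hFG : F ≠ 0 ∨ G ≠ 0) :
    ∃ (d : K[X]) (a b : K), d ≠ 0 ∧ (a ≠ 0 ∨ b ≠ 0) ∧ F = C a * d ∧ G = C b * d := by
  have hd : gcd F G ≠ 0 := by
    intro h0
    rw [gcd_eq_zero_iff] at h0
    tauto
  obtain ⟨F₁, hF₁⟩ := gcd_dvd_left F G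
  obtain ⟨G₁, hG₁⟩ := gcd_dvd_right F G
  set d := gcd F G with hddef
  have hcop : IsCoprime F₁ G₁ := by
    rw [← gcd_isUnit_iff]
    have h1 : gcd (d * F₁) (d * G₁) = normalize d * gcd F₁ G₁ := gcd_mul_left _ _ _
    rw [← hF₁, ← hG₁, ← hddef] at h1
    have h2 : Associated (normalize d) d := normalize_associated d
    rw [hddef, normalize_gcd, ← hddef] at h1
    have h3 : gcd F₁ G₁ = 1 := mul_left_cancel₀ hd (by rw [← h1, mul_one])
    rw [h3]
    exact isUnit_one
  have hw : wronskian F₁ G₁ = 0 := by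
    have h1 : wronskian F G = d * d * wronskian F₁ G₁ := by
      simp only [wronskian]
      rw [hF₁, hG₁]
      simp only [derivative_mul]
      ring
    rw [h] at h1
    rcases mul_eq_zero.mp h1.symm with h2 | h2
    · exact absurd (mul_self_eq_zero.mp h2) hd
    · exact h2
  obtain ⟨h1, h2⟩ := hcop.wronskian_eq_zero_iff.mp hw
  have h3 := eq_C_of_natDegree_eq_zero (derivative_eq_zero.mp h1)
  have h4 := eq_C_of_natDegree_eq_zero (derivative_eq_zero.mp h2)
  refine ⟨d, F₁.coeff 0, G₁.coeff 0, hd, ?_, ?_, ?_⟩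
  · by_contra hcon
    push Not at hcon
    rw [hcon.1, C_0] at h3
    rw [hcon.2, C_0] at h4
    rw [h3, mul_zero] at hF₁
    rw [h4, mul_zero] at hG₁
    tauto
  · rw [← h3, mul_comm]; exact hF₁
  · rw [← h4, mul_comm]; exact hG₁

open Polynomial in
theorem wronskian_ne_zero_of_auxiliary (g : ℤ[X])
    (hsep : (g.map (Int.castRingHom ℚ)).Separable) (hr : 8 ≤ g.natDegree) {n : ℕ} (hn : 1 ≤ n)
    {F G : ℤ[X]} (hF : F.natDegree ≤ (g.natDegree - 2) * n)
    (hG : G.natDegree ≤ (g.natDegree - 2) * n) (hFG : F ≠ 0 ∨ G ≠ 0)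
    (hdvd : ∀ i < n, g ∣ hasseDeriv i F - X * hasseDeriv i G) : wronskian F G ≠ 0 := by
  intro hw
  set φ := Int.castRingHom ℂ with hφ
  have hinj : Function.Injective φ := Int.cast_injective
  have hw' : wronskian (F.map φ) (G.map φ) = 0 := by
    have : wronskian (F.map φ) (G.map φ) = (wronskian F G).map φ := by
      simp only [wronskian, derivative_map, Polynomial.map_sub, Polynomial.map_mul]
    rw [this, hw, Polynomial.map_zero]
  obtain ⟨d, a, b, hd, hab, hFd, hGd⟩ := exists_common_factor_of_wronskian_eq_zero hw'
    (hFG.imp (fun h => (Polynomial.map_ne_zero_iff hinj).mpr h)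
      fun h => (Polynomial.map_ne_zero_iff hinj).mpr h)
  have hdN : d.natDegree ≤ (g.natDegree - 2) * n := by
    rcases hab with ha | hb
    · rw [← natDegree_C_mul (p := d) ha, ← hFd]
      exact natDegree_map_le.trans hF
    · rw [← natDegree_C_mul (p := d) hb, ← hGd]
      exact natDegree_map_le.trans hG
  have hsepC : (g.map φ).Separable := by
    have h1 : g.map φ = (g.map (Int.castRingHom ℚ)).map (algebraMap ℚ ℂ) := by
      rw [Polynomial.map_map]; congr 1
    rw [h1]
    exact hsep.map
  set Z := (g.map φ).roots.toFinset with hZ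
  have hZcard : Z.card = g.natDegree := by
    rw [hZ, Multiset.toFinset_card_of_nodup (nodup_roots hsepC),
      IsAlgClosed.card_roots_eq_natDegree, natDegree_map_eq_of_injective hinj]
  set Z' := Z.filter fun z => a - z * b ≠ 0 with hZ'
  have hZ'card : g.natDegree ≤ Z'.card + 1 := by
    have h1 : (Z \ Z').card + Z'.card = Z.card :=
      Finset.card_sdiff_add_card_eq_card (Finset.filter_subset _ _)
    have h2 : (Z \ Z').card ≤ 1 := by
      rw [Finset.card_le_one]
      have hmem : ∀ z, z ∈ Z \ Z' → z ∈ Z ∧ a - z * b = 0 := by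
        intro z hz
        rw [Finset.mem_sdiff, hZ', Finset.mem_filter] at hz
        tauto
      intro z hz w hw
      replace hz := hmem z hz
      replace hw := hmem w hw
      have h3 : b ≠ 0 := by
        intro hb
        have := hz.2
        rw [hb, mul_zero, sub_zero] at this
        tauto
      have h4 : (z - w) * b = 0 := by linear_combination hw.2 - hz.2
      rcases mul_eq_zero.mp h4 with h5 | h5
      · exact sub_eq_zero.mp h5
      · exact absurd h5 h3
    omega
  have hroot : ∀ z ∈ Z', (X - C z) ^ n ∣ d := by
    intro z hz
    refine X_sub_C_pow_dvd_of_hasseDeriv_eval fun i hi => ?_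
    obtain ⟨Q, hQ⟩ := hdvd i hi
    have hgz : (g.map φ).eval z = 0 := by
      have := (Finset.mem_filter.mp hz).1
      rw [hZ, Multiset.mem_toFinset] at this
      exact isRoot_of_mem_roots this
    have h1 := congrArg (fun p => (p.map φ).eval z) hQ
    simp only [Polynomial.map_sub, Polynomial.map_mul, ← hasseDeriv_map_ringHom, eval_sub,
      eval_mul, hgz, zero_mul, map_X, eval_X, hFd, hGd, ← smul_eq_C_mul, map_smul, eval_smul,
      smul_eq_mul] at h1
    have h2 : (a - z * b) * (hasseDeriv i d).eval z = 0 := by linear_combination h1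
    exact (mul_eq_zero.mp h2).resolve_left (Finset.mem_filter.mp hz).2
  have hprod : ∏ z ∈ Z', (X - C z) ^ n ∣ d := by
    refine Finset.prod_dvd_of_coprime (fun z _ w _ hzw => ?_) hroot
    exact (pairwise_coprime_X_sub_C (s := fun z : ℂ => z) Function.injective_id hzw).pow
  have h1 := natDegree_le_of_dvd hprod hd
  rw [Finset.prod_pow, natDegree_pow, natDegree_prod_of_monic _ _ fun z _ => monic_X_sub_C z] at h1
  simp only [natDegree_X_sub_C, Finset.sum_const, smul_eq_mul, mul_one] at h1
  have h2 : n * Z'.card ≤ (g.natDegree - 2) * n := h1.trans hdN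
  rw [mul_comm] at h2
  have := Nat.le_of_mul_le_mul_right h2 hn
  omega

/-- The multiplicative height of a rational number. -/
def ratHeight (x : ℚ) : ℝ := max |(x.num : ℝ)| (x.den : ℝ)

open Polynomial in
theorem ratHeight_pow_le_of_pow_dvd (x : ℚ) (t : ℕ) {W : ℤ[X]} (hW : W ≠ 0) {B : ℝ} (hB1 : 1 ≤ B)
    (hB : ∀ i, |(W.coeff i : ℝ)| ≤ B)
    (hdvd : (X - C x) ^ t ∣ W.map (Int.castRingHom ℚ)) : ratHeight x ^ t ≤ B := by
  set L : ℤ[X] := C (x.den : ℤ) * X - C x.num with hL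
  have hden : (x.den : ℤ) ≠ 0 := by exact_mod_cast x.den_nz
  have hLprim : L.IsPrimitive := by
    intro c hc
    rw [C_dvd_iff_dvd_coeff] at hc
    have h0 := hc 0
    have h1 := hc 1
    simp [hL, coeff_X, coeff_C, -eq_intCast] at h0 h1
    have hcop : IsCoprime x.num (x.den : ℤ) := by
      rw [Int.isCoprime_iff_gcd_eq_one]
      exact x.reduced
    exact hcop.isUnit_of_dvd' h0 h1
  have hLpow : ∀ k : ℕ, (L ^ k).IsPrimitive := by
    intro k
    induction k with
    | zero => simp
    | succ k ih => rw [pow_succ]; exact ih.mul hLprim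
  have hLmap : L.map (Int.castRingHom ℚ) = C (x.den : ℚ) * (X - C x) := by
    have hx : (x.num : ℚ) = x.den * x := (Rat.den_mul_eq_num x).symm
    simp only [hL, Polynomial.map_sub, Polynomial.map_mul, map_C, map_X]
    have e : (Int.castRingHom ℚ) x.num = x.den * x := by simp
    rw [e, C_mul]
    simp only [eq_intCast, Int.cast_natCast]
    ring
  have hLW : L ^ t ∣ W := by
    rw [IsPrimitive.Int.dvd_iff_map_cast_dvd_map_cast _ _ (hLpow t), Polynomial.map_pow, hLmap,
      mul_pow, ← C_pow]
    refine (IsUnit.mul_left_dvd (isUnit_C.mpr (IsUnit.pow _ ?_))).mpr hdvd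
    exact isUnit_iff_ne_zero.mpr (by exact_mod_cast x.den_nz)
  obtain ⟨U, hU⟩ := hLW
  have hU0 : U ≠ 0 := by rintro rfl; exact hW (by rw [hU, mul_zero])
  have habs : ∀ m : ℤ, ∀ i, W.coeff i ≠ 0 → m ^ t ∣ W.coeff i → |(m : ℝ)| ^ t ≤ B := by
    intro m i h0 hm
    refine le_trans ?_ (hB i)
    have := Int.le_of_dvd (abs_pos.mpr h0) ((dvd_abs _ _).mpr ((abs_dvd _ _).mpr hm))
    rw [abs_pow] at this
    exact_mod_cast this
  have h1 : (x.den : ℝ) ^ t ≤ B := by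
    have hlead : L.leadingCoeff = x.den := by
      rw [hL, sub_eq_add_neg, ← C_neg]
      exact leadingCoeff_linear hden
    have h2 := habs x.den W.natDegree (leadingCoeff_ne_zero.mpr hW) (by
      change _ ∣ W.leadingCoeff
      rw [hU, leadingCoeff_mul, leadingCoeff_pow, hlead]
      exact dvd_mul_right _ _)
    simpa using h2
  have h2 : |(x.num : ℝ)| ^ t ≤ B := by
    by_cases h0 : x.num = 0
    · rw [h0, Int.cast_zero, abs_zero]
      exact (pow_le_one₀ le_rfl zero_le_one).trans hB1
    · refine habs x.num W.natTrailingDegree (trailingCoeff_nonzero_iff_nonzero.mpr hW) ?_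
      change _ ∣ W.trailingCoeff
      have hc0 : (L ^ t).coeff 0 = (-x.num) ^ t := by
        rw [coeff_zero_eq_eval_zero]; simp [hL]
      rw [hU, trailingCoeff_mul, trailingCoeff_eq_coeff_zero (p := L ^ t)
        (by rw [hc0]; exact pow_ne_zero _ (neg_ne_zero.mpr h0)), hc0]
      exact Dvd.dvd.mul_right (pow_dvd_pow_of_dvd ((dvd_neg).mpr dvd_rfl) _) _
  rcases le_total |(x.num : ℝ)| (x.den : ℝ) with h | h
  · rw [ratHeight, max_eq_right h]; exact h1
  · rw [ratHeight, max_eq_left h]; exact h2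

open Polynomial in
/-- The zero estimate: the derivatives of the auxiliary polynomial cannot vanish to high order. -/
theorem ratHeight_pow_le_of_auxiliary_vanishing (g : ℤ[X])
    (hsep : (g.map (Int.castRingHom ℚ)).Separable) (hr : 8 ≤ g.natDegree) {n : ℕ} (hn : 1 ≤ n)
    {F G : ℤ[X]} (hF : F.natDegree ≤ (g.natDegree - 2) * n)
    (hG : G.natDegree ≤ (g.natDegree - 2) * n) (hFG : F ≠ 0 ∨ G ≠ 0)
    (hdvd : ∀ i < n, g ∣ hasseDeriv i F - X * hasseDeriv i G) {c : ℝ} (hc : 1 ≤ c)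
    (hFc : ∀ i, |(F.coeff i : ℝ)| ≤ c ^ n) (hGc : ∀ i, |(G.coeff i : ℝ)| ≤ c ^ n)
    (x y : ℚ) (t : ℕ)
    (hvan : ∀ j ≤ t, aeval x (hasseDeriv j F) = y * aeval x (hasseDeriv j G)) :
    ratHeight x ^ t ≤ (4 ^ g.natDegree * c ^ 2) ^ n := by
  have hW := wronskian_ne_zero_of_auxiliary g hsep hr hn hF hG hFG hdvd
  set N := (g.natDegree - 2) * n with hN
  have hNr : N + 2 * n = g.natDegree * n := by
    rw [hN, ← add_mul]; congr 1; omega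
  refine ratHeight_pow_le_of_pow_dvd x t hW (one_le_pow₀ ?_) ?_ ?_
  · exact one_le_mul_of_one_le_of_one_le (one_le_pow₀ (by norm_num)) (one_le_pow₀ hc)
  · intro i
    by_cases hi : i ≤ 2 * N
    · have hder : ∀ (P : ℤ[X]), P.natDegree ≤ N → (∀ i, |(P.coeff i : ℝ)| ≤ c ^ n) →
          ∀ i, |((derivative P).coeff i : ℝ)| ≤ c ^ n * (N + 1) := by
        intro P hP hPc i
        rw [coeff_derivative]
        push_cast
        by_cases h : i + 1 ≤ N
        · rw [abs_mul, abs_of_nonneg (a := (i : ℝ) + 1) (by positivity)]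
          have : (i : ℝ) + 1 ≤ N := by exact_mod_cast h
          exact mul_le_mul (hPc _) (by linarith) (by positivity) (by positivity)
        · rw [coeff_eq_zero_of_natDegree_lt (by omega)]
          simp only [Int.cast_zero, zero_mul, abs_zero]
          positivity
      have hmul : ∀ (P Q : ℤ[X]), (∀ i, |(P.coeff i : ℝ)| ≤ c ^ n) →
          (∀ i, |(Q.coeff i : ℝ)| ≤ c ^ n * (N + 1)) →
          |((P * Q).coeff i : ℝ)| ≤ (2 * N + 1) * (c ^ n * (c ^ n * (N + 1))) := by
        intro P Q hP hQ
        rw [coeff_mul]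
        push_cast
        refine (Finset.abs_sum_le_sum_abs _ _).trans ((Finset.sum_le_card_nsmul _ _
          (c ^ n * (c ^ n * (N + 1))) fun x _ => ?_).trans ?_)
        · rw [abs_mul]
          exact mul_le_mul (hP _) (hQ _) (abs_nonneg _) (by positivity)
        · rw [Finset.Nat.card_antidiagonal, nsmul_eq_mul]
          gcongr
          exact_mod_cast Nat.succ_le_succ hi
      have h1 := hmul F (derivative G) hFc (hder G hG hGc)
      have h2 := hmul G (derivative F) hGc (hder F hF hFc)
      have h3 : ((wronskian F G).coeff i : ℝ) = ((F * derivative G).coeff i : ℝ)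
          - ((G * derivative F).coeff i : ℝ) := by
        rw [wronskian, coeff_sub, mul_comm (derivative F)]
        push_cast
        ring
      rw [h3]
      have h2N : (N + 1 : ℝ) ≤ 2 ^ N := by exact_mod_cast Nat.lt_two_pow_self (n := N)
      have h4 : (4 : ℝ) ^ (N + 1) ≤ 4 ^ (g.natDegree * n) :=
        pow_le_pow_right₀ (by norm_num) (by omega)
      calc _ ≤ _ := abs_sub _ _
        _ ≤ _ := add_le_add h1 h2
        _ = (2 * (2 * N + 1)) * (N + 1) * (c ^ n * c ^ n) := by ring
        _ ≤ (4 * 2 ^ N) * 2 ^ N * (c ^ n * c ^ n) := by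
          have h5 : (2 * (2 * N + 1) : ℝ) ≤ 4 * 2 ^ N := by linarith
          gcongr
        _ = 4 ^ (N + 1) * (c ^ n * c ^ n) := by
          rw [pow_succ, show (4 : ℝ) ^ N = 2 ^ N * 2 ^ N by rw [← mul_pow]; norm_num]; ring
        _ ≤ 4 ^ (g.natDegree * n) * (c ^ n * c ^ n) := by gcongr
        _ = _ := by rw [pow_mul, mul_pow, ← pow_add, ← pow_mul]; ring
    · rw [coeff_eq_zero_of_natDegree_lt]
      · simp only [Int.cast_zero, abs_zero]; positivity
      · refine lt_of_le_of_lt ?_ (not_le.mp hi)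
        have h1 : (derivative G).natDegree ≤ N := (natDegree_derivative_le G).trans (by omega)
        have h2 : (derivative F).natDegree ≤ N := (natDegree_derivative_le F).trans (by omega)
        refine (natDegree_sub_le _ _).trans (max_le ?_ ?_) <;>
          refine natDegree_mul_le.trans (by omega)
  · set φ := Int.castRingHom ℚ with hφ
    set Φ := F.map φ - C y * G.map φ with hΦ
    have h1 : (X - C x) ^ (t + 1) ∣ Φ := by
      refine X_sub_C_pow_dvd_of_hasseDeriv_eval fun j hj => ?_
      have := hvan j (by omega)
      rw [hΦ, map_sub, ← smul_eq_C_mul, map_smul, hasseDeriv_map_ringHom, hasseDeriv_map_ringHom,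
        eval_sub, eval_smul, eval_map, eval_map, smul_eq_mul]
      simp only [aeval_def, algebraMap_int_eq] at this
      rw [this, sub_self]
    have h2 : (X - C x) ^ t ∣ derivative Φ := by
      simpa using pow_sub_one_dvd_derivative_of_pow_dvd h1
    have h3 : (wronskian F G).map φ = Φ * derivative (G.map φ) - derivative Φ * G.map φ := by
      simp only [wronskian, hΦ, derivative_sub, derivative_mul, derivative_C, derivative_map,
        Polynomial.map_sub, Polynomial.map_mul]
      ring
    rw [h3]
    exact dvd_sub (Dvd.dvd.mul_right ((pow_dvd_pow _ (by omega)).trans h1) _)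
      (Dvd.dvd.mul_right h2 _)

open Polynomial in
theorem absoluteValue_aeval_le (v : AbsoluteValue ℚ ℝ) {P : ℤ[X]} {N : ℕ} (hN : P.natDegree ≤ N)
    {B : ℝ} (hB : ∀ i, |(P.coeff i : ℝ)| ≤ B) (x : ℚ) :
    v (aeval x P) ≤ (N + 1) * B * max 1 (v x) ^ N := by
  rw [aeval_eq_sum_range' (Nat.lt_succ_of_le hN)]
  refine (v.sum_le _ _).trans ?_
  calc ∑ i ∈ Finset.range (N + 1), v (P.coeff i • x ^ i)
      ≤ ∑ _i ∈ Finset.range (N + 1), B * max 1 (v x) ^ N := by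
        refine Finset.sum_le_sum fun i hi => ?_
        rw [zsmul_eq_mul, v.map_mul, v.map_pow]
        have h1 : v x ^ i ≤ max 1 (v x) ^ N :=
          (pow_le_pow_left₀ (v.nonneg _) (le_max_right _ _) _).trans
            (pow_le_pow_right₀ (le_max_left _ _) (Nat.lt_succ_iff.mp (Finset.mem_range.mp hi)))
        have h0 : 0 ≤ B := (abs_nonneg _).trans (hB 0)
        exact mul_le_mul ((absoluteValue_intCast_le v _).trans (hB i)) h1
          (pow_nonneg (v.nonneg _) _) h0
    _ = _ := by rw [Finset.sum_const, Finset.card_range, nsmul_eq_mul]; push_cast; ring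

open Polynomial in
theorem exists_absoluteValue_eval_le (v : AbsoluteValue ℚ ℝ) (P : ℚ[X]) (A : ℝ) :
    ∃ B : ℝ, 1 ≤ B ∧ ∀ x, v x ≤ A → v (P.eval x) ≤ B := by
  refine ⟨1 + ∑ i ∈ Finset.range (P.natDegree + 1), v (P.coeff i) * max 1 A ^ i, ?_, ?_⟩
  · have : 0 ≤ ∑ i ∈ Finset.range (P.natDegree + 1), v (P.coeff i) * max 1 A ^ i :=
      Finset.sum_nonneg fun i _ => mul_nonneg (v.nonneg _) (by positivity)
    linarith
  · intro x hx
    rw [eval_eq_sum_range]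
    refine (v.sum_le _ _).trans ?_
    have : ∑ i ∈ Finset.range (P.natDegree + 1), v (P.coeff i * x ^ i) ≤
        ∑ i ∈ Finset.range (P.natDegree + 1), v (P.coeff i) * max 1 A ^ i := by
      refine Finset.sum_le_sum fun i _ => ?_
      rw [v.map_mul, v.map_pow]
      exact mul_le_mul_of_nonneg_left
        (pow_le_pow_left₀ (v.nonneg _) (hx.trans (le_max_right _ _)) _) (v.nonneg _)
    linarith

open Polynomial in
theorem eval_eq_sum_hasseDeriv {R : Type*} [CommRing R] (P : R[X]) {N : ℕ} (hN : P.natDegree ≤ N)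
    (x y : R) : P.eval x = ∑ i ∈ Finset.range (N + 1), (hasseDeriv i P).eval y * (x - y) ^ i := by
  have h := taylor_eval y P (x - y)
  rw [sub_add_cancel] at h
  rw [← h, eval_eq_sum_range' (n := N + 1) (by rw [natDegree_taylor]; omega)]
  exact Finset.sum_congr rfl fun i _ => by rw [taylor_coeff]

open Polynomial in
/-- Away from large arguments, points at which `g` is small and which lie close to one another are
as close as the values of `g` allow. -/
theorem exists_absoluteValue_sub_le (v : AbsoluteValue ℚ ℝ) (g : ℚ[X]) (hsep : g.Separable)
    (A : ℝ) : ∃ K δ τ : ℝ, 1 ≤ K ∧ 0 < δ ∧ 0 < τ ∧ ∀ x y, v x ≤ A → v y ≤ A →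
      v (g.eval x) ≤ τ → v (x - y) < δ → v (x - y) ≤ K * (v (g.eval x) + v (g.eval y)) := by
  obtain ⟨a, b, hab⟩ := hsep
  obtain ⟨B₁, hB₁, h₁⟩ := exists_absoluteValue_eval_le v a A
  obtain ⟨B₂, hB₂, h₂⟩ := exists_absoluteValue_eval_le v b A
  have h3 : ∀ i, ∃ B : ℝ, 1 ≤ B ∧ ∀ x, v x ≤ A → v ((hasseDeriv i g).eval x) ≤ B :=
    fun i => exists_absoluteValue_eval_le v (hasseDeriv i g) A
  choose B hB1 hB using h3
  set N := g.natDegree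
  set R := ∑ i ∈ Finset.range N, B (i + 2) with hR
  have hR0 : 0 ≤ R := Finset.sum_nonneg fun i _ => by linarith [hB1 (i + 2)]
  refine ⟨4 * B₂, min 1 (1 / (4 * B₂ * (R + 1))), 1 / (2 * B₁), by linarith, by positivity,
    by positivity, fun x y hx hy hgx hxy => ?_⟩
  have hd1 : v (x - y) ≤ 1 := hxy.le.trans (min_le_left _ _)
  have hd2 : v (x - y) * (4 * B₂ * (R + 1)) ≤ 1 := by
    have := hxy.le.trans (min_le_right _ _)
    rwa [le_div_iff₀ (by positivity)] at this
  -- the derivative is not small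
  have hder : 1 ≤ 2 * B₂ * v (g.derivative.eval x) := by
    have h := congrArg (Polynomial.eval x) hab
    rw [eval_add, eval_mul, eval_mul, eval_one] at h
    have h1 : (1 : ℝ) ≤ v (a.eval x) * v (g.eval x) + v (b.eval x) * v (g.derivative.eval x) := by
      rw [← v.map_mul, ← v.map_mul, ← v.map_one, ← h]
      exact v.add_le _ _
    have h2 : v (a.eval x) * v (g.eval x) ≤ B₁ * (1 / (2 * B₁)) :=
      mul_le_mul (h₁ x hx) hgx (v.nonneg _) (by linarith)
    have h3 : v (b.eval x) * v (g.derivative.eval x) ≤ B₂ * v (g.derivative.eval x) :=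
      mul_le_mul_of_nonneg_right (h₂ x hx) (v.nonneg _)
    have h4 : B₁ * (1 / (2 * B₁)) = 1 / 2 := by field_simp
    linarith
  have hT := eval_eq_sum_hasseDeriv g (N := N + 1) (Nat.le_succ _) y x
  rw [Finset.sum_range_succ', Finset.sum_range_succ'] at hT
  simp only [hasseDeriv_zero', pow_zero, mul_one, zero_add, hasseDeriv_one', pow_one] at hT
  set T := ∑ i ∈ Finset.range N, (hasseDeriv (i + 1 + 1) g).eval x * (y - x) ^ (i + 1 + 1) with hTd
  have hyx : v (y - x) = v (x - y) := v.map_sub y x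
  have hTle : v T ≤ R * v (x - y) ^ 2 := by
    rw [hTd, hR, Finset.sum_mul]
    refine (v.sum_le _ _).trans (Finset.sum_le_sum fun i _ => ?_)
    rw [v.map_mul, v.map_pow, hyx]
    exact mul_le_mul (hB _ x hx) (pow_le_pow_of_le_one (v.nonneg _) hd1 (by omega))
      (pow_nonneg (v.nonneg _) _) (by linarith [hB1 (i + 2)])
  have hlin : v (g.derivative.eval x) * v (x - y) ≤
      v (g.eval y) + v (g.eval x) + R * v (x - y) ^ 2 := by
    rw [← hyx, ← v.map_mul, hyx]
    have : g.derivative.eval x * (y - x) = g.eval y - g.eval x - T := by rw [hT]; ring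
    rw [this]
    have h5 := v.sub_le_add (g.eval y - g.eval x) T
    have h6 := v.sub_le_add (g.eval y) (g.eval x)
    linarith
  have h7 : v (x - y) ≤ 2 * B₂ * (v (g.derivative.eval x) * v (x - y)) := by
    have := mul_le_mul_of_nonneg_right hder (v.nonneg (x - y))
    linarith
  have h8 : 2 * B₂ * (R * v (x - y) ^ 2) ≤ v (x - y) / 2 := by
    have := mul_le_mul_of_nonneg_right hd2 (v.nonneg (x - y))
    have h9 : 0 ≤ B₂ * v (x - y) ^ 2 := by positivity
    nlinarith
  have h9 : 2 * B₂ * (v (g.derivative.eval x) * v (x - y)) ≤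
      2 * B₂ * (v (g.eval y) + v (g.eval x) + R * v (x - y) ^ 2) :=
    mul_le_mul_of_nonneg_left hlin (by linarith)
  nlinarith

open Polynomial in
/-- If a monic polynomial takes a value that is small relative to the argument, then the argument
is bounded. -/
theorem exists_absoluteValue_le_of_monic (v : AbsoluteValue ℚ ℝ) (g : ℚ[X]) (hg : g.Monic) :
    ∃ A : ℝ, 1 ≤ A ∧ ∀ x, v (g.eval x) < 1 / 2 * max 1 (v x) ^ g.natDegree → v x ≤ A := by
  set r := g.natDegree with hr
  set s := ∑ i ∈ Finset.range r, v (g.coeff i) with hs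
  have hs0 : 0 ≤ s := Finset.sum_nonneg fun _ _ => v.nonneg _
  refine ⟨1 + 2 * s, by linarith, fun x hx => ?_⟩
  by_contra! hlt
  have h1 : 1 ≤ v x := by linarith
  rw [max_eq_right h1] at hx
  have hev : x ^ r = g.eval x - ∑ i ∈ Finset.range r, g.coeff i * x ^ i := by
    rw [eval_eq_sum_range, Finset.sum_range_succ, ← hr]
    have : g.coeff r = 1 := hg
    rw [this]; ring
  have h2 : v x ^ r ≤ v (g.eval x) + v (∑ i ∈ Finset.range r, g.coeff i * x ^ i) := by
    rw [← v.map_pow, hev]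
    exact v.sub_le_add _ _
  have h3 : v x * v (∑ i ∈ Finset.range r, g.coeff i * x ^ i) ≤ s * v x ^ r := by
    calc v x * v (∑ i ∈ Finset.range r, g.coeff i * x ^ i)
        ≤ v x * ∑ i ∈ Finset.range r, v (g.coeff i * x ^ i) :=
          mul_le_mul_of_nonneg_left (v.sum_le _ _) (v.nonneg _)
      _ = ∑ i ∈ Finset.range r, v (g.coeff i) * v x ^ (i + 1) := by
          rw [Finset.mul_sum]
          exact Finset.sum_congr rfl fun i _ => by rw [v.map_mul, v.map_pow]; ring
      _ ≤ _ := by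
          rw [hs, Finset.sum_mul]
          refine Finset.sum_le_sum fun i hi => mul_le_mul_of_nonneg_left
            (pow_le_pow_right₀ h1 (Finset.mem_range.mp hi)) (v.nonneg _)
  have h4 : 0 < v x ^ r := pow_pos (by linarith) _
  nlinarith

open Polynomial in
/-- A pair of polynomials such that `F - β G` vanishes to order `n` at every root `β` of `g`, with
exponentially bounded coefficients. -/
def IsAuxiliaryPair (g : ℤ[X]) (c : ℝ) (n : ℕ) (F G : ℤ[X]) : Prop :=
  F.natDegree ≤ (g.natDegree - 2) * n ∧ G.natDegree ≤ (g.natDegree - 2) * n ∧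
    (F ≠ 0 ∨ G ≠ 0) ∧ (∀ i, |(F.coeff i : ℝ)| ≤ c ^ n) ∧ (∀ i, |(G.coeff i : ℝ)| ≤ c ^ n) ∧
    ∀ i < n, ∃ Q : ℤ[X], hasseDeriv i F - X * hasseDeriv i G = g * Q ∧
      ∀ (v : AbsoluteValue ℚ ℝ) (y : ℚ),
        v (aeval y Q) ≤ (c * max 1 (v y) ^ g.natDegree) ^ n

open Polynomial in
theorem abs_coeff_hasseDeriv_le {P : ℤ[X]} {N : ℕ} (hN : P.natDegree ≤ N) {B : ℝ}
    (hB : ∀ i, |(P.coeff i : ℝ)| ≤ B) (j i : ℕ) :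
    |((hasseDeriv j P).coeff i : ℝ)| ≤ 2 ^ N * B := by
  have hB0 : 0 ≤ B := (abs_nonneg _).trans (hB 0)
  rw [hasseDeriv_coeff]
  by_cases h : i + j ≤ N
  · push_cast
    rw [abs_mul, Nat.abs_cast]
    refine mul_le_mul ?_ (hB _) (abs_nonneg _) (by positivity)
    have h1 : (i + j).choose j ≤ 2 ^ (i + j) := Nat.choose_le_two_pow _ _
    have h2 : 2 ^ (i + j) ≤ 2 ^ N := Nat.pow_le_pow_right (by norm_num) h
    exact_mod_cast h1.trans h2
  · rw [coeff_eq_zero_of_natDegree_lt (by omega)]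
    simp only [mul_zero, Int.cast_zero, abs_zero]
    positivity

open Polynomial in
theorem IsAuxiliaryPair.absoluteValue_le {g : ℤ[X]} {c : ℝ} {n : ℕ} {F G : ℤ[X]} (hn : 1 ≤ n)
    (hr : 8 ≤ g.natDegree) (hc : 1 ≤ c)
    (h : IsAuxiliaryPair g c n F G) (v : AbsoluteValue ℚ ℝ) (x y : ℚ) (j : ℕ) :
    v (aeval x (hasseDeriv j F) - y * aeval x (hasseDeriv j G)) ≤
      (4 ^ g.natDegree * c) ^ n * max 1 (v x) ^ ((g.natDegree - 2) * n) * max 1 (v y) := by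
  obtain ⟨hF, hG, -, hFc, hGc, -⟩ := h
  set N := (g.natDegree - 2) * n with hN
  have hNr : N + 2 * n = g.natDegree * n := by
    rw [hN, ← add_mul]; congr 1; omega
  have hc0 : 0 < c := by linarith
  have hb : ∀ P : ℤ[X], P.natDegree ≤ N → (∀ i, |(P.coeff i : ℝ)| ≤ c ^ n) →
      v (aeval x (hasseDeriv j P)) ≤ 4 ^ N * c ^ n * 2 * max 1 (v x) ^ N := by
    intro P hP hPc
    refine (absoluteValue_aeval_le v ((natDegree_hasseDeriv_le P j).trans ((Nat.sub_le _ _).trans hP))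
      (abs_coeff_hasseDeriv_le hP hPc j) x).trans ?_
    refine mul_le_mul_of_nonneg_right ?_ (by positivity)
    have h1 : ((N : ℝ) + 1) ≤ 2 ^ N := by
      have : N + 1 ≤ 2 ^ N := Nat.lt_two_pow_self
      exact_mod_cast this
    have h4 : (4 : ℝ) ^ N = 2 ^ N * 2 ^ N := by rw [← mul_pow]; norm_num
    have h2 : ((N : ℝ) + 1) * (2 ^ N * c ^ n) ≤ 2 ^ N * (2 ^ N * c ^ n) :=
      mul_le_mul_of_nonneg_right h1 (by positivity)
    have h3 : 0 ≤ (2 : ℝ) ^ N * (2 ^ N * c ^ n) := by positivity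
    rw [h4]
    linarith
  have h1 := v.sub_le_add (aeval x (hasseDeriv j F)) (y * aeval x (hasseDeriv j G))
  rw [v.map_mul] at h1
  have h2 := hb F hF hFc
  have h3 := hb G hG hGc
  have h4 : v y * v (aeval x (hasseDeriv j G)) ≤
      max 1 (v y) * (4 ^ N * c ^ n * 2 * max 1 (v x) ^ N) :=
    mul_le_mul (le_max_right _ _) h3 (v.nonneg _) (by positivity)
  have h5 : 1 * (4 ^ N * c ^ n * 2 * max 1 (v x) ^ N) ≤
      max 1 (v y) * (4 ^ N * c ^ n * 2 * max 1 (v x) ^ N) :=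
    mul_le_mul_of_nonneg_right (le_max_left _ _) (by positivity)
  have h6 : (4 : ℝ) ^ N * 4 ≤ 4 ^ (g.natDegree * n) := by
    rw [← pow_succ]
    exact pow_le_pow_right₀ (by norm_num) (by omega)
  have h7 : 4 ^ N * 4 * (c ^ n * max 1 (v x) ^ N * max 1 (v y)) ≤
      4 ^ (g.natDegree * n) * (c ^ n * max 1 (v x) ^ N * max 1 (v y)) :=
    mul_le_mul_of_nonneg_right h6 (by positivity)
  rw [mul_pow, ← pow_mul]
  linarith

open Polynomial in
theorem IsAuxiliaryPair.sub_eq_sum {g : ℤ[X]} {c : ℝ} {n : ℕ} {F G : ℤ[X]}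
    (h : IsAuxiliaryPair g c n F G) (x y : ℚ) (j : ℕ) :
    aeval x (hasseDeriv j F) - y * aeval x (hasseDeriv j G) =
      ∑ i ∈ Finset.range ((g.natDegree - 2) * n + 1), (((i + j).choose i : ℕ) : ℚ) * (x - y) ^ i *
        (aeval y (hasseDeriv (i + j) F) - y * aeval y (hasseDeriv (i + j) G)) := by
  obtain ⟨hF, hG, -⟩ := h
  set N := (g.natDegree - 2) * n with hN
  have key : ∀ P : ℤ[X], P.natDegree ≤ N → aeval x (hasseDeriv j P) =
      ∑ i ∈ Finset.range (N + 1), (((i + j).choose i : ℕ) : ℚ) * (x - y) ^ i *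
        aeval y (hasseDeriv (i + j) P) := by
    intro P hP
    have h1 := eval_eq_sum_hasseDeriv ((hasseDeriv j P).map (Int.castRingHom ℚ)) (N := N)
      (natDegree_map_le.trans ((natDegree_hasseDeriv_le P j).trans ((Nat.sub_le _ _).trans hP))) x y
    simp only [hasseDeriv_map_ringHom, eval_map] at h1
    simp only [aeval_def, algebraMap_int_eq]
    rw [h1]
    refine Finset.sum_congr rfl fun i _ => ?_
    have h2 : hasseDeriv i (hasseDeriv j P) = (i + j).choose i • hasseDeriv (i + j) P := by
      rw [← LinearMap.comp_apply, hasseDeriv_comp, LinearMap.smul_apply]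
    rw [h2, nsmul_eq_mul, eval₂_mul, eval₂_natCast]
    ring
  rw [key F hF, key G hG, Finset.mul_sum, ← Finset.sum_sub_distrib]
  exact Finset.sum_congr rfl fun i _ => by ring

open Polynomial in
/-- The main local estimate: at one absolute value, `D^j F(x) - y D^j G(x)` is small if `x` and `y`
approximate the same root of `g`. -/
theorem exists_local_bound (v : AbsoluteValue ℚ ℝ)
    (htb : ∀ A δ : ℝ, 0 < δ → ∃ col : ℚ → Set ℚ, (Set.range col).Finite ∧
      ∀ x y, v x ≤ A → v y ≤ A → col x = col y → v (x - y) < δ)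
    (g : ℤ[X]) (hg : g.Monic) (hsep : (g.map (Int.castRingHom ℚ)).Separable)
    (hr : 8 ≤ g.natDegree) {c : ℝ} (hc : 1 ≤ c) :
    ∃ col : ℚ → Set ℚ, (Set.range col).Finite ∧ ∃ C : ℝ, 1 ≤ C ∧
      ∀ n : ℕ, 1 ≤ n → ∀ F G : ℤ[X], IsAuxiliaryPair g c n F G → ∀ x y, col x = col y → ∀ j < n,
        v (aeval x (hasseDeriv j F) - y * aeval x (hasseDeriv j G)) ≤
          C ^ n * max 1 (v x) ^ ((g.natDegree - 2) * n) * max 1 (v y) *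
            max ((v (aeval x g) / max 1 (v x) ^ g.natDegree) ^ (n - j))
              (v (aeval y g) / max 1 (v y) ^ g.natDegree) := by
  have haev : ∀ (P : ℤ[X]) (x : ℚ), (P.map (Int.castRingHom ℚ)).eval x = aeval x P := by
    intro P x
    rw [eval_map, aeval_def, algebraMap_int_eq]
  obtain ⟨A, hA1, hA⟩ := exists_absoluteValue_le_of_monic v _ (hg.map (Int.castRingHom ℚ))
  rw [hg.natDegree_map] at hA
  obtain ⟨K, δ, τ, hK, hδ, hτ, hKb⟩ := exists_absoluteValue_sub_le v _ hsep A
  simp only [haev] at hA hKb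
  obtain ⟨col, hcol, hcolb⟩ := htb A (min 1 δ) (by positivity)
  set r := g.natDegree with hrdef
  have hA0 : 0 < A := by linarith
  have hAr : 1 ≤ A ^ r := one_le_pow₀ hA1
  set τ' : ℝ := min (1 / 2) τ / A ^ r with hτ'
  have hτ'0 : 0 < τ' := by positivity
  have hτ'1 : τ' ≤ 1 / 2 := by
    rw [hτ', div_le_iff₀ (by positivity)]
    nlinarith [min_le_left (1 / 2) τ]
  have hτ'2 : τ' * A ^ r ≤ min (1 / 2) τ := by
    rw [hτ', div_mul_cancel₀ _ (by positivity)]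
  set K' : ℝ := 2 * K * A ^ r with hK'
  have hK'1 : 1 ≤ K' := by nlinarith
  set D : ℝ := 4 ^ r * c * A ^ (2 * r) * K' with hD
  have hA2r : 1 ≤ A ^ (2 * r) := one_le_pow₀ hA1
  have h4r : (1 : ℝ) ≤ 4 ^ r := one_le_pow₀ (by norm_num)
  have hD1 : 4 ^ r * c ≤ D := by
    rw [hD, mul_assoc (4 ^ r * c)]
    exact le_mul_of_one_le_right (by positivity) (one_le_mul_of_one_le_of_one_le hA2r hK'1)
  have h4c : 1 ≤ 4 ^ r * c := one_le_mul_of_one_le_of_one_le h4r hc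
  refine ⟨col, hcol, 4 ^ r * D / τ', ?_, fun n hn F G hFG x y hxy j hj => ?_⟩
  · rw [le_div_iff₀ hτ'0]
    nlinarith
  set N := (r - 2) * n with hN
  have hNr : N + 2 * n = r * n := by
    rw [hN, ← add_mul]; congr 1; omega
  set wx := v (aeval x g) / max 1 (v x) ^ r with hwx
  set wy := v (aeval y g) / max 1 (v y) ^ r with hwy
  have hwx0 : 0 ≤ wx := div_nonneg (v.nonneg _) (by positivity)
  have hwy0 : 0 ≤ wy := div_nonneg (v.nonneg _) (by positivity)
  have hH : 0 ≤ max 1 (v x) ^ N * max 1 (v y) := by positivity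
  by_cases hbig : τ' ^ n ≤ max (wx ^ (n - j)) wy
  · refine (hFG.absoluteValue_le hn hr hc v x y j).trans ?_
    have h1 : (4 ^ r * c) ^ n ≤ (4 ^ r * D / τ') ^ n * max (wx ^ (n - j)) wy := by
      calc (4 ^ r * c) ^ n ≤ (4 ^ r * D / τ') ^ n * τ' ^ n := by
            rw [← mul_pow, div_mul_cancel₀ _ hτ'0.ne']
            exact pow_le_pow_left₀ (by positivity) (by nlinarith) _
        _ ≤ _ := mul_le_mul_of_nonneg_left hbig (by positivity)
    calc (4 ^ r * c) ^ n * max 1 (v x) ^ N * max 1 (v y)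
        = (4 ^ r * c) ^ n * (max 1 (v x) ^ N * max 1 (v y)) := by ring
      _ ≤ ((4 ^ r * D / τ') ^ n * max (wx ^ (n - j)) wy) * (max 1 (v x) ^ N * max 1 (v y)) :=
          mul_le_mul_of_nonneg_right h1 hH
      _ = _ := by ring
  · push Not at hbig
    obtain ⟨hb1, hb2⟩ := max_lt_iff.mp hbig
    have hnj : n - j ≠ 0 := by omega
    have hwxτ : wx < τ' := by
      refine lt_of_pow_lt_pow_left₀ (n - j) hτ'0.le (hb1.trans_le ?_)
      exact pow_le_pow_of_le_one hτ'0.le (by linarith) (by omega)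
    have hwyτ : wy < τ' := hb2.trans_le (by
      simpa using pow_le_pow_of_le_one hτ'0.le (by linarith) hn)
    have hval : ∀ z : ℚ, v (aeval z g) / max 1 (v z) ^ r < τ' →
        v z ≤ A ∧ v (aeval z g) ≤ A ^ r * (v (aeval z g) / max 1 (v z) ^ r) := by
      intro z hz
      have hp : 0 < max 1 (v z) ^ r := by positivity
      have h1 : v z ≤ A := by
        refine hA z ?_
        rw [div_lt_iff₀ hp] at hz
        exact hz.trans_le (mul_le_mul_of_nonneg_right hτ'1 hp.le)
      refine ⟨h1, ?_⟩
      have h2 : max 1 (v z) ^ r ≤ A ^ r := pow_le_pow_left₀ (by positivity) (max_le hA1 h1) _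
      calc v (aeval z g) = max 1 (v z) ^ r * (v (aeval z g) / max 1 (v z) ^ r) := by
            rw [mul_div_cancel₀ _ hp.ne']
        _ ≤ _ := mul_le_mul_of_nonneg_right h2 (div_nonneg (v.nonneg _) hp.le)
    obtain ⟨hxA, hgx⟩ := hval x hwxτ
    obtain ⟨hyA, hgy⟩ := hval y hwyτ
    have hθδ := hcolb x y hxA hyA hxy
    set θ := v (x - y) with hθ
    have hθ0 : 0 ≤ θ := v.nonneg _
    have hθ1 : θ ≤ 1 := hθδ.le.trans (min_le_left _ _)
    have hgxτ : v (aeval x g) ≤ τ := by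
      have h1 : A ^ r * wx ≤ A ^ r * τ' := mul_le_mul_of_nonneg_left hwxτ.le (by positivity)
      linarith [min_le_right (1 / 2) τ]
    have hθK := hKb x y hxA hyA hgxτ (hθδ.trans_le (min_le_right _ _))
    have hθm : θ ≤ K' * max wx wy := by
      have h1 : v (aeval x g) + v (aeval y g) ≤ A ^ r * (2 * max wx wy) := by
        have h2 : A ^ r * (wx + wy) ≤ A ^ r * (2 * max wx wy) :=
          mul_le_mul_of_nonneg_left (by linarith [le_max_left wx wy, le_max_right wx wy])
            (by positivity)
        linarith
      calc θ ≤ K * (v (aeval x g) + v (aeval y g)) := hθK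
        _ ≤ K * (A ^ r * (2 * max wx wy)) := mul_le_mul_of_nonneg_left h1 (by linarith)
        _ = _ := by rw [hK']; ring
    set μ := max (wx ^ (n - j)) wy with hμ
    have hμ0 : 0 ≤ μ := hwy0.trans (le_max_right _ _)
    have hθn : θ ^ (n - j) ≤ K' ^ n * μ := by
      rcases le_total wy wx with h | h
      · rw [max_eq_left h] at hθm
        calc θ ^ (n - j) ≤ (K' * wx) ^ (n - j) := pow_le_pow_left₀ hθ0 hθm _
          _ = K' ^ (n - j) * wx ^ (n - j) := mul_pow _ _ _
          _ ≤ K' ^ n * μ := mul_le_mul (pow_le_pow_right₀ hK'1 (by omega)) (le_max_left _ _)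
              (by positivity) (by positivity)
      · rw [max_eq_right h] at hθm
        calc θ ^ (n - j) ≤ θ ^ 1 := pow_le_pow_of_le_one hθ0 hθ1 (by omega)
          _ ≤ K' ^ 1 * wy := by simpa using hθm
          _ ≤ K' ^ n * μ := mul_le_mul (pow_le_pow_right₀ hK'1 hn) (le_max_right _ _)
              hwy0 (by positivity)
    have hterm : ∀ i ∈ Finset.range (N + 1), v ((((i + j).choose i : ℕ) : ℚ) * (x - y) ^ i *
        (aeval y (hasseDeriv (i + j) F) - y * aeval y (hasseDeriv (i + j) G))) ≤
          2 ^ (N + n) * (D ^ n * μ) := by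
      intro i hi
      have hiN : i ≤ N := Nat.lt_succ_iff.mp (Finset.mem_range.mp hi)
      have hch : v (((i + j).choose i : ℕ) : ℚ) ≤ 2 ^ (N + n) := by
        have h1 := absoluteValue_intCast_le v ((i + j).choose i : ℤ)
        rw [Int.cast_natCast] at h1
        refine h1.trans ?_
        rw [Int.cast_natCast, Nat.abs_cast]
        have h2 : (i + j).choose i ≤ 2 ^ (N + n) :=
          (Nat.choose_le_two_pow _ _).trans (Nat.pow_le_pow_right (by norm_num) (by omega))
        exact_mod_cast h2
      rw [v.map_mul, v.map_mul, v.map_pow, mul_assoc]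
      refine mul_le_mul hch ?_ (by positivity) (by positivity)
      by_cases hij : i + j < n
      · obtain ⟨Q, hQ, hQb⟩ := hFG.2.2.2.2.2 (i + j) hij
        have h1 : aeval y (hasseDeriv (i + j) F) - y * aeval y (hasseDeriv (i + j) G) =
            aeval y g * aeval y Q := by
          rw [← map_mul, ← hQ]
          simp
        rw [h1, v.map_mul]
        have h2 : v (aeval y Q) ≤ (c * A ^ r) ^ n := (hQb v y).trans
          (pow_le_pow_left₀ (by positivity) (mul_le_mul_of_nonneg_left
            (pow_le_pow_left₀ (by positivity) (max_le hA1 hyA) _) (by linarith)) _)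
        calc θ ^ i * (v (aeval y g) * v (aeval y Q))
            ≤ 1 * ((A ^ r * wy) * (c * A ^ r) ^ n) :=
              mul_le_mul (pow_le_one₀ hθ0 hθ1) (mul_le_mul hgy h2 (v.nonneg _) (by positivity))
                (mul_nonneg (v.nonneg _) (v.nonneg _)) zero_le_one
          _ ≤ ((A ^ r) ^ n * (c * A ^ r) ^ n) * wy := by
              have h3 : A ^ r ≤ (A ^ r) ^ n := le_self_pow₀ hAr (by omega)
              have h4 : A ^ r * (wy * (c * A ^ r) ^ n) ≤ (A ^ r) ^ n * (wy * (c * A ^ r) ^ n) :=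
                mul_le_mul_of_nonneg_right h3 (by positivity)
              linarith
          _ = (c * A ^ (2 * r)) ^ n * wy := by rw [← mul_pow]; congr 2; ring
          _ ≤ D ^ n * μ := by
              refine mul_le_mul (pow_le_pow_left₀ (by positivity) ?_ _) (le_max_right _ _) hwy0
                (by positivity)
              have h5 : 1 * (c * A ^ (2 * r)) ≤ (4 ^ r * K') * (c * A ^ (2 * r)) :=
                mul_le_mul_of_nonneg_right (one_le_mul_of_one_le_of_one_le h4r hK'1)
                  (by positivity)
              rw [hD]
              linarith
      · have h1 := hFG.absoluteValue_le hn hr hc v y y (i + j)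
        have hmx : max 1 (v y) ≤ A := max_le hA1 hyA
        have h2 : v (aeval y (hasseDeriv (i + j) F) - y * aeval y (hasseDeriv (i + j) G)) ≤
            (4 ^ r * c) ^ n * (A ^ (2 * r)) ^ n := by
          refine h1.trans ?_
          rw [mul_assoc, ← pow_succ]
          refine mul_le_mul_of_nonneg_left ?_ (by positivity)
          calc max 1 (v y) ^ (N + 1) ≤ A ^ (N + 1) := pow_le_pow_left₀ (by positivity) hmx _
            _ ≤ A ^ (2 * r * n) := pow_le_pow_right₀ hA1 (by
                rw [mul_assoc]; omega)
            _ = _ := pow_mul _ _ _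
        calc θ ^ i * v (aeval y (hasseDeriv (i + j) F) - y * aeval y (hasseDeriv (i + j) G))
            ≤ (K' ^ n * μ) * ((4 ^ r * c) ^ n * (A ^ (2 * r)) ^ n) :=
              mul_le_mul ((pow_le_pow_of_le_one hθ0 hθ1 (by omega)).trans hθn) h2 (v.nonneg _)
                (by positivity)
          _ = D ^ n * μ := by rw [hD, mul_pow, mul_pow]; ring
    rw [hFG.sub_eq_sum x y j]
    refine (v.sum_le _ _).trans ((Finset.sum_le_sum hterm).trans ?_)
    rw [Finset.sum_const, Finset.card_range, nsmul_eq_mul]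
    have hH1 : 1 ≤ max 1 (v x) ^ N * max 1 (v y) :=
      one_le_mul_of_one_le_of_one_le (one_le_pow₀ (le_max_left _ _)) (le_max_left _ _)
    have hcount : ((N + 1 : ℕ) : ℝ) * 2 ^ (N + n) ≤ (4 ^ r) ^ n := by
      have h1 : N + 1 ≤ 2 ^ N := Nat.lt_two_pow_self
      have h2 : (N + 1) * 2 ^ (N + n) ≤ 2 ^ N * 2 ^ (N + n) := Nat.mul_le_mul_right _ h1
      have h3 : 2 ^ N * 2 ^ (N + n) ≤ (4 ^ r) ^ n := by
        rw [← pow_add, ← pow_mul, show (4 : ℕ) = 2 ^ 2 by norm_num, ← pow_mul]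
        exact Nat.pow_le_pow_right (by norm_num) (by omega)
      exact_mod_cast h2.trans h3
    have hDt : 4 ^ r * D ≤ 4 ^ r * D / τ' := by
      rw [le_div_iff₀ hτ'0]
      exact mul_le_of_le_one_right (by positivity) (by linarith)
    have hDp : (4 ^ r) ^ n * D ^ n ≤ (4 ^ r * D / τ') ^ n := by
      rw [← mul_pow]
      exact pow_le_pow_left₀ (by positivity) hDt _
    calc ((N + 1 : ℕ) : ℝ) * (2 ^ (N + n) * (D ^ n * μ))
        = (((N + 1 : ℕ) : ℝ) * 2 ^ (N + n)) * (D ^ n * μ) := by ring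
      _ ≤ (4 ^ r) ^ n * (D ^ n * μ) := mul_le_mul_of_nonneg_right hcount (by positivity)
      _ = (4 ^ r) ^ n * D ^ n * μ * 1 := by ring
      _ ≤ (4 ^ r * D / τ') ^ n * μ * (max 1 (v x) ^ N * max 1 (v y)) :=
          mul_le_mul (mul_le_mul_of_nonneg_right hDp hμ0) hH1 zero_le_one (by positivity)
      _ = _ := by ring

theorem finite_setOf_ratHeight_le (B : ℝ) : {x : ℚ | ratHeight x ≤ B}.Finite := by
  obtain ⟨K, hK⟩ := exists_nat_ge B
  refine Set.Finite.of_finite_image (f := fun x : ℚ => (x.num, (x.den : ℤ)))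
    (((Set.finite_Icc (-(K : ℤ)) K).prod (Set.finite_Icc (-(K : ℤ)) K)).subset ?_) ?_
  · rintro _ ⟨x, hx, rfl⟩
    have h : ratHeight x ≤ K := le_trans hx hK
    obtain ⟨h1, h2⟩ := max_le_iff.mp h
    obtain ⟨h3, h4⟩ := abs_le.mp h1
    refine ⟨⟨by exact_mod_cast h3, by exact_mod_cast h4⟩, ⟨?_, ?_⟩⟩
    · have : (0 : ℤ) ≤ x.den := by positivity
      have : (0 : ℤ) ≤ K := by positivity
      show -(K : ℤ) ≤ x.den
      omega
    · show (x.den : ℤ) ≤ K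
      exact_mod_cast h2
  · intro x _ y _ hxy
    simp only [Prod.mk.injEq, Nat.cast_inj] at hxy
    exact Rat.ext hxy.1 hxy.2

theorem one_le_ratHeight (x : ℚ) : 1 ≤ ratHeight x :=
  le_max_of_le_right (by exact_mod_cast x.den_pos)

open Polynomial in
theorem exists_intCast_eq_den_pow_mul_aeval (P : ℤ[X]) {N : ℕ} (hN : P.natDegree ≤ N) (x : ℚ) :
    ∃ m : ℤ, (m : ℚ) = (x.den : ℚ) ^ N * aeval x P := by
  refine ⟨∑ i ∈ Finset.range (N + 1), P.coeff i * x.num ^ i * x.den ^ (N - i), ?_⟩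
  rw [aeval_eq_sum_range' (Nat.lt_succ_of_le hN), Finset.mul_sum]
  push_cast
  refine Finset.sum_congr rfl fun i hi => ?_
  have hi' : i ≤ N := Nat.lt_succ_iff.mp (Finset.mem_range.mp hi)
  have hx : (x.num : ℚ) = x * x.den := (Rat.mul_den_eq_num x).symm
  rw [zsmul_eq_mul, hx, mul_pow]
  have : (x.den : ℚ) ^ N = x.den ^ i * x.den ^ (N - i) := by rw [← pow_add]; congr 1; omega
  rw [this]
  ring

set_option maxHeartbeats 1000000 in
open Polynomial in
theorem finite_of_prod_absoluteValue_eq_one {ι : Type} [Fintype ι] (v : ι → AbsoluteValue ℚ ℝ)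
    (htb : ∀ i, ∀ A δ : ℝ, 0 < δ → ∃ col : ℚ → Set ℚ, (Set.range col).Finite ∧
      ∀ x y, v i x ≤ A → v i y ≤ A → col x = col y → v i (x - y) < δ)
    (hprod : ∀ x : ℚ, ∏ i, (v i x.den * max 1 (v i x)) = ratHeight x)
    (hint : ∀ Z : ℤ, Z ≠ 0 → 1 ≤ ∏ i, v i (Z : ℚ))
    (g : ℤ[X]) (hg : g.Monic) (hsep : (g.map (Int.castRingHom ℚ)).Separable)
    (hr : 8 ≤ g.natDegree) (E : Set ℚ)
    (hE : ∀ x ∈ E, ∏ i, v i ((x.den : ℚ) ^ g.natDegree * aeval x g) = 1) : E.Finite := by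
  by_contra hinf
  obtain ⟨c, hc, haux⟩ := exists_auxiliary_pair g hg hr
  choose col hcol C hC hloc using fun i => exists_local_bound (v i) (htb i) g hg hsep hr hc
  set r := g.natDegree with hrdef
  set h : ℚ → ℝ := fun x => Real.log (ratHeight x) with hh
  set w : ι → ℚ → ℝ := fun i x => v i (aeval x g) / max 1 (v i x) ^ r with hw
  -- bounds for `w`
  obtain ⟨c₀, hc₀, hwc⟩ : ∃ c₀ : ℝ, 0 ≤ c₀ ∧ ∀ i x, w i x ≤ Real.exp c₀ := by
    obtain ⟨B, hB⟩ : ∃ B : ℝ, ∀ i, |(g.coeff i : ℝ)| ≤ B := by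
      refine ⟨∑ i ∈ Finset.range (r + 1), |(g.coeff i : ℝ)|, fun i => ?_⟩
      by_cases hi : i ∈ Finset.range (r + 1)
      · exact Finset.single_le_sum (f := fun i => |(g.coeff i : ℝ)|) (fun _ _ => abs_nonneg _) hi
      · rw [coeff_eq_zero_of_natDegree_lt (by simpa using hi)]
        simpa using Finset.sum_nonneg fun i _ => abs_nonneg (g.coeff i : ℝ)
    have hB0 : 0 ≤ B := (abs_nonneg _).trans (hB 0)
    refine ⟨(r + 1) * B, by positivity, fun i x => ?_⟩
    have h1 := absoluteValue_aeval_le (v i) le_rfl hB x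
    rw [hw]
    simp only
    rw [div_le_iff₀ (by positivity)]
    refine h1.trans (mul_le_mul_of_nonneg_right ?_ (by positivity))
    linarith [Real.add_one_le_exp ((r + 1) * B)]
  have hden : ∀ (x : ℚ) i, 0 < v i x.den := fun x i =>
    (v i).pos (by exact_mod_cast x.den_ne_zero)
  have hwpos : ∀ x ∈ E, ∀ i, 0 < w i x := by
    intro x hx i
    have h1 : v i ((x.den : ℚ) ^ r * aeval x g) ≠ 0 := by
      intro h0
      have h2 := hE x hx
      rw [Finset.prod_eq_zero (Finset.mem_univ i) h0] at h2
      exact zero_ne_one h2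
    rw [(v i).map_mul] at h1
    exact div_pos (lt_of_le_of_ne ((v i).nonneg _) (right_ne_zero_of_mul h1).symm) (by positivity)
  set l : ι → ℚ → ℝ := fun i x => c₀ - Real.log (w i x) with hl
  have hl0 : ∀ x ∈ E, ∀ i, 0 ≤ l i x := by
    intro x hx i
    have := Real.log_le_log (hwpos x hx i) (hwc i x)
    rw [Real.log_exp] at this
    simp only [hl]
    linarith
  set s : ℝ := (Fintype.card ι : ℝ) with hs
  have hlsum : ∀ x ∈ E, ∑ i, l i x = s * c₀ + r * h x := by
    intro x hx
    have h1 : ∑ i, Real.log (w i x) = - (r * h x) := by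
      rw [← Real.log_prod (fun i _ => (hwpos x hx i).ne')]
      have h2 : (∏ i, w i x) * ratHeight x ^ r = 1 := by
        rw [← hprod, ← Finset.prod_pow, ← Finset.prod_mul_distrib]
        refine Eq.trans ?_ (hE x hx)
        refine Finset.prod_congr rfl fun i _ => ?_
        have : max 1 (v i x) ^ r ≠ 0 := by positivity
        simp only [hw, (v i).map_mul, (v i).map_pow]
        field_simp
        ring
      have hpos : 0 < ratHeight x := by linarith [one_le_ratHeight x]
      have h3 : ∏ i, w i x = (ratHeight x ^ r)⁻¹ := eq_inv_of_mul_eq_one_left h2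
      rw [h3, Real.log_inv, Real.log_pow]
    simp only [hl, Finset.sum_sub_distrib, h1, Finset.sum_const, Finset.card_univ, nsmul_eq_mul]
    ring
  have hs0 : 0 ≤ s := Nat.cast_nonneg _
  have hr0 : (8 : ℝ) ≤ r := by exact_mod_cast hr
  obtain ⟨ε, hε, hεrs⟩ : ∃ ε : ℝ, 0 < ε ∧ ε * (r + s) = 1 / 4 :=
    ⟨1 / (4 * (r + s)), by positivity, by field_simp⟩
  set k : ι → ℚ → ℕ := fun i x => ⌊l i x / (ε * h x)⌋₊ with hk
  -- an infinite set of points of the same colour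
  set E' := {x ∈ E | 1 ≤ h x} with hE'
  have hE'inf : E'.Infinite := by
    intro hfin
    refine hinf ((hfin.union (finite_setOf_ratHeight_le (Real.exp 1))).subset fun x hx => ?_)
    by_cases h1 : 1 ≤ h x
    · exact Or.inl ⟨hx, h1⟩
    · refine Or.inr ?_
      push Not at h1
      have hpos : 0 < ratHeight x := by linarith [one_le_ratHeight x]
      exact (Real.log_le_iff_le_exp hpos).mp h1.le
  obtain ⟨κ, hκ⟩ : ∃ κ : ι → Set ℚ × ℕ,
      (E' ∩ (fun x => fun i => (col i x, k i x)) ⁻¹' {κ}).Infinite := by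
    by_contra! hcon
    refine hE'inf (Set.Finite.of_finite_fibers (fun x => fun i => (col i x, k i x)) ?_
      fun κ _ => hcon κ)
    refine (Set.Finite.pi' (t := fun i => Set.range (col i) ×ˢ Set.Iic ⌊(s * c₀ + r) / ε⌋₊)
      fun i => (hcol i).prod (Set.finite_Iic _)).subset ?_
    rintro _ ⟨x, ⟨hx, hx1⟩, rfl⟩ i
    refine ⟨⟨x, rfl⟩, Nat.floor_le_floor ?_⟩
    have h1 : l i x ≤ s * c₀ + r * h x := by
      rw [← hlsum x hx]
      exact Finset.single_le_sum (f := fun i => l i x) (fun j _ => hl0 x hx j) (Finset.mem_univ i)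
    have hx0 : 0 < h x := by linarith
    rw [div_le_div_iff₀ (by positivity) hε]
    have h2 : s * c₀ ≤ s * c₀ * h x := le_mul_of_one_le_right (by positivity) hx1
    have h3 : l i x ≤ (s * c₀ + r) * h x := by linarith
    nlinarith
  have hlarge : ∀ B : ℝ, ∃ x ∈ E' ∩ (fun x => fun i => (col i x, k i x)) ⁻¹' {κ}, B < h x := by
    intro B
    by_contra! hcon
    refine hκ ((finite_setOf_ratHeight_le (Real.exp B)).subset fun x hx => ?_)
    have hpos : 0 < ratHeight x := by linarith [one_le_ratHeight x]
    exact (Real.log_le_iff_le_exp hpos).mp (hcon x hx)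
  -- the two points and the parameters
  set Λ : ℝ := Real.log (∏ i, C i) with hΛ
  have hCprod : 1 ≤ ∏ i, C i := by
    rw [← Finset.prod_const_one (s := (Finset.univ : Finset ι))]
    exact Finset.prod_le_prod (fun _ _ => zero_le_one) fun i _ => hC i
  have hΛ0 : 0 ≤ Λ := Real.log_nonneg hCprod
  set D : ℝ := 4 ^ r * c ^ 2 with hD
  have hD0 : 0 < D := by positivity
  obtain ⟨x₁, ⟨⟨hx₁E, hx₁1⟩, hx₁κ⟩, hx₁⟩ :=
    hlarge (max (2 * (Λ + s * c₀)) (2 * |Real.log D| / ε))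
  obtain ⟨hx₁a, hx₁b⟩ := max_lt_iff.mp hx₁
  obtain ⟨n₀, hn₀⟩ := exists_nat_ge (max 4 (2 / ε))
  obtain ⟨x₂, ⟨⟨hx₂E, hx₂1⟩, hx₂κ⟩, hx₂⟩ := hlarge (n₀ * h x₁)
  have hκeq : ∀ i, col i x₁ = col i x₂ ∧ k i x₁ = k i x₂ := by
    intro i
    have h1 := congrFun (hx₁κ.trans (Eq.symm hx₂κ)) i
    exact Prod.mk.injEq _ _ _ _ ▸ h1
  have hh₁ : 0 < h x₁ := by linarith
  set n := ⌊h x₂ / h x₁⌋₊ with hn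
  have hnn₀ : n₀ ≤ n := by
    rw [hn]
    refine Nat.le_floor ?_
    rw [le_div_iff₀ hh₁]
    exact hx₂.le
  have hnR : max 4 (2 / ε) ≤ (n : ℝ) := hn₀.trans (by exact_mod_cast hnn₀)
  have hn4 : (4 : ℝ) ≤ n := (le_max_left _ _).trans hnR
  have hnε : 2 ≤ ε * n := by
    have := (le_max_right _ _).trans hnR
    rw [div_le_iff₀ hε] at this
    linarith
  have hn1 : 1 ≤ n := by
    have : (1 : ℝ) ≤ n := by linarith
    exact_mod_cast this
  have hnle : n * h x₁ ≤ h x₂ := by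
    rw [← le_div_iff₀ hh₁]
    exact Nat.floor_le (by positivity)
  have hnlt : h x₂ ≤ (n + 1) * h x₁ := by
    rw [← div_le_iff₀ hh₁]
    exact (Nat.lt_floor_add_one _).le
  obtain ⟨F, G, hF, hG, hFG, hFc, hGc, hQ⟩ := haux n hn1
  set N := (r - 2) * n with hN
  have hNR : (N : ℝ) = (r - 2) * n := by
    rw [hN]; push_cast [Nat.cast_sub (show 2 ≤ r by omega)]; ring
  -- a nonvanishing derivative
  set t := ⌊ε * n⌋₊ with ht
  have htle : (t : ℝ) ≤ ε * n := Nat.floor_le (by positivity)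
  have htlt : ε * n < t + 1 := Nat.lt_floor_add_one _
  obtain ⟨j, hjt, hj⟩ : ∃ j ≤ t,
      aeval x₁ (hasseDeriv j F) - x₂ * aeval x₁ (hasseDeriv j G) ≠ 0 := by
    by_contra! hcon
    have h1 := ratHeight_pow_le_of_auxiliary_vanishing g hsep hr hn1 hF hG hFG
      (fun i hi => by obtain ⟨Q, hQ, -⟩ := hQ i hi; exact ⟨Q, hQ⟩) hc hFc hGc x₁ x₂ t
      (fun j hj => sub_eq_zero.mp (hcon j hj))
    have hpos : 0 < ratHeight x₁ := by linarith [one_le_ratHeight x₁]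
    have h2 := Real.log_le_log (by positivity) h1
    rw [Real.log_pow, Real.log_pow] at h2
    have h3 : ε * n / 2 ≤ t := by linarith
    have h4 : ε * n / 2 * h x₁ ≤ t * h x₁ := mul_le_mul_of_nonneg_right h3 hh₁.le
    rw [div_lt_iff₀ hε] at hx₁b
    have h5 : (n : ℝ) * Real.log D ≤ n * |Real.log D| :=
      mul_le_mul_of_nonneg_left (le_abs_self _) (by positivity)
    nlinarith
  have hε4 : ε ≤ 1 / 4 := by nlinarith
  have hjε : (j : ℝ) ≤ ε * n := (Nat.cast_le.mpr hjt).trans htle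
  have hjn : j < n := by
    have : (j : ℝ) < n := by nlinarith
    exact_mod_cast this
  set z := aeval x₁ (hasseDeriv j F) - x₂ * aeval x₁ (hasseDeriv j G) with hz
  -- lower bound
  have hlower : 1 ≤ ∏ i, v i ((x₁.den : ℚ) ^ N * x₂.den * z) := by
    obtain ⟨a, ha⟩ := exists_intCast_eq_den_pow_mul_aeval (hasseDeriv j F)
      ((natDegree_hasseDeriv_le F j).trans ((Nat.sub_le _ _).trans hF)) x₁
    obtain ⟨b, hb⟩ := exists_intCast_eq_den_pow_mul_aeval (hasseDeriv j G)
      ((natDegree_hasseDeriv_le G j).trans ((Nat.sub_le _ _).trans hG)) x₁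
    have h1 : ((a * x₂.den - b * x₂.num : ℤ) : ℚ) = (x₁.den : ℚ) ^ N * x₂.den * z := by
      push_cast
      rw [ha, hb, ← Rat.mul_den_eq_num x₂, hz]
      ring
    rw [← h1]
    refine hint _ fun h0 => ?_
    rw [h0, Int.cast_zero] at h1
    have : (x₁.den : ℚ) ^ N * x₂.den ≠ 0 := by
      have h2 : (x₁.den : ℚ) ≠ 0 := by exact_mod_cast x₁.den_ne_zero
      have h3 : (x₂.den : ℚ) ≠ 0 := by exact_mod_cast x₂.den_ne_zero
      positivity
    exact (mul_ne_zero this hj) h1.symm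
  -- upper bound
  set M : ι → ℝ := fun i => Real.exp (n * c₀ - ε * k i x₁ * ((n - j) * h x₁)) with hM
  have hnj : ((n - j : ℕ) : ℝ) = n - j := by rw [Nat.cast_sub hjn.le]
  have hwk : ∀ x ∈ E, 1 ≤ h x → ∀ i, w i x ≤ Real.exp (c₀ - ε * k i x * h x) := by
    intro x hx hx1 i
    rw [← Real.log_le_iff_le_exp (hwpos x hx i)]
    have h0 : 0 < h x := by linarith
    have h1 : (k i x : ℝ) ≤ l i x / (ε * h x) := Nat.floor_le (by have := hl0 x hx i; positivity)
    rw [le_div_iff₀ (by positivity)] at h1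
    simp only [hl] at h1
    linarith
  have hmax : ∀ i, max (w i x₁ ^ (n - j)) (w i x₂) ≤ M i := by
    intro i
    have hk0 : 0 ≤ ε * k i x₁ := by positivity
    have hjn' : (j : ℝ) ≤ n := by exact_mod_cast hjn.le
    have hj0 : (0 : ℝ) ≤ j := Nat.cast_nonneg _
    refine max_le ?_ ?_
    · refine (pow_le_pow_left₀ (hwpos x₁ hx₁E i).le (hwk x₁ hx₁E hx₁1 i) _).trans ?_
      rw [← Real.exp_nat_mul, hnj]
      refine Real.exp_le_exp.mpr ?_
      have := mul_nonneg hj0 hc₀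
      linarith
    · refine (hwk x₂ hx₂E hx₂1 i).trans (Real.exp_le_exp.mpr ?_)
      rw [← (hκeq i).2]
      have h1 : (n - j) * h x₁ ≤ h x₂ := by
        have := mul_nonneg hj0 hh₁.le
        linarith
      have h2 : c₀ ≤ n * c₀ := le_mul_of_one_le_left hc₀ (by linarith)
      have h3 := mul_le_mul_of_nonneg_left h1 hk0
      linarith
  have hupper : ∏ i, v i ((x₁.den : ℚ) ^ N * x₂.den * z) ≤
      (∏ i, C i) ^ n * ratHeight x₁ ^ N * ratHeight x₂ * ∏ i, M i := by
    rw [← hprod, ← hprod, ← Finset.prod_pow, ← Finset.prod_pow, ← Finset.prod_mul_distrib,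
      ← Finset.prod_mul_distrib, ← Finset.prod_mul_distrib]
    refine Finset.prod_le_prod (fun i _ => (v i).nonneg _) fun i _ => ?_
    have h1 := hloc i n hn1 F G ⟨hF, hG, hFG, hFc, hGc, hQ⟩ x₁ x₂ (hκeq i).1 j hjn
    have h2 : C i ^ n * max 1 (v i x₁) ^ N * max 1 (v i x₂) *
        max (w i x₁ ^ (n - j)) (w i x₂) ≤
        C i ^ n * max 1 (v i x₁) ^ N * max 1 (v i x₂) * M i :=
      mul_le_mul_of_nonneg_left (hmax i) (by have := hC i; positivity)
    rw [(v i).map_mul, (v i).map_mul, (v i).map_pow]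
    have h3 := mul_le_mul_of_nonneg_left (h1.trans h2)
      (show 0 ≤ v i x₁.den ^ N * v i x₂.den by
        have := hden x₁ i; have := hden x₂ i; positivity)
    refine h3.trans (le_of_eq ?_)
    rw [mul_pow]
    ring
  have hfin := Real.log_le_log one_pos (hlower.trans hupper)
  have hp₁ : 0 < ratHeight x₁ := by linarith [one_le_ratHeight x₁]
  have hp₂ : 0 < ratHeight x₂ := by linarith [one_le_ratHeight x₂]
  have hMpos : 0 < ∏ i, M i := Finset.prod_pos fun i _ => Real.exp_pos _
  rw [Real.log_one, Real.log_mul (by positivity) hMpos.ne', Real.log_mul (by positivity) hp₂.ne',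
    Real.log_mul (by positivity) (by positivity), Real.log_pow, Real.log_pow,
    Real.log_prod (fun i _ => (Real.exp_pos _).ne')] at hfin
  simp only [Real.log_exp, Finset.sum_sub_distrib, Finset.sum_const, Finset.card_univ,
    nsmul_eq_mul, ← Finset.sum_mul, ← hs] at hfin
  have hksum : r - ε * s ≤ ∑ i, ε * (k i x₁ : ℝ) := by
    have h1 : ∀ i, l i x₁ ≤ (ε * k i x₁ + ε) * h x₁ := by
      intro i
      have h2 : l i x₁ / (ε * h x₁) < k i x₁ + 1 := Nat.lt_floor_add_one _
      rw [div_lt_iff₀ (by positivity)] at h2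
      linarith
    have h2 := Finset.sum_le_sum fun i (_ : i ∈ Finset.univ) => h1 i
    rw [hlsum x₁ hx₁E, ← Finset.sum_mul, Finset.sum_add_distrib] at h2
    simp only [Finset.sum_const, Finset.card_univ, nsmul_eq_mul, ← hs] at h2
    have h3 : 0 ≤ s * c₀ := by positivity
    have h4 : r * h x₁ ≤ (∑ i, ε * (k i x₁ : ℝ) + s * ε) * h x₁ := by linarith
    have h5 := le_of_mul_le_mul_right h4 hh₁
    linarith
  set σ := ∑ i, ε * (k i x₁ : ℝ) with hσ
  have hjnR : (1 - ε) * n ≤ (n : ℝ) - j := by linarith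
  have hεs : ε * s ≤ 1 / 4 := by nlinarith
  have h1 : (r - ε * s) * ((1 - ε) * n) ≤ σ * (n - j) :=
    mul_le_mul hksum hjnR (by nlinarith) (by linarith)
  have h2 : (r - 1 / 4) * n ≤ (r - ε * s) * ((1 - ε) * n) := by
    have : 0 ≤ ε * s * ε * n := by positivity
    nlinarith
  have h3 : ((r - 1 / 4) * n) * h x₁ ≤ σ * (n - j) * h x₁ :=
    mul_le_mul_of_nonneg_right (h2.trans h1) hh₁.le
  rw [hNR] at hfin
  have h4 : (n : ℝ) * (2 * (Λ + s * c₀)) < n * h x₁ :=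
    mul_lt_mul_of_pos_left hx₁a (by linarith)
  have h5 : 4 * h x₁ ≤ n * h x₁ := mul_le_mul_of_nonneg_right hn4 hh₁.le
  change 0 ≤ n * Λ + (r - 2) * n * h x₁ + h x₂ + (s * (n * c₀) - σ * ((n - j) * h x₁)) at hfin
  linarith

theorem exists_finite_coloring {E : Type*} [NormedField E] [ProperSpace E] (φ : ℚ →+* E) (A δ : ℝ)
    (hδ : 0 < δ) : ∃ col : ℚ → Set ℚ, (Set.range col).Finite ∧
      ∀ x y, ‖φ x‖ ≤ A → ‖φ y‖ ≤ A → col x = col y → ‖φ (x - y)‖ < δ := by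
  obtain ⟨t, ht, hcov⟩ := Metric.totallyBounded_iff.mp
    (isCompact_closedBall (0 : E) A).totallyBounded (δ / 2) (by positivity)
  have hc : ∀ x : ℚ, ‖φ x‖ ≤ A → ∃ c ∈ t, dist (φ x) c < δ / 2 := by
    intro x hx
    have h1 : φ x ∈ Metric.closedBall (0 : E) A := by simpa using hx
    simpa using hcov h1
  refine ⟨fun x => if h : ‖φ x‖ ≤ A then {z | dist (φ z) (hc x h).choose < δ / 2} else ∅,
    ((ht.image fun c => {z : ℚ | dist (φ z) c < δ / 2}).union (Set.finite_singleton ∅)).subset ?_,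
    fun x y hx hy hxy => ?_⟩
  · rintro _ ⟨x, rfl⟩
    by_cases h : ‖φ x‖ ≤ A
    · exact Or.inl ⟨_, (hc x h).choose_spec.1, by simp only [h, dif_pos]⟩
    · exact Or.inr (by simp only [h, dif_neg, not_false_eq_true]; rfl)
  · simp only [hx, hy, dif_pos] at hxy
    have h1 : x ∈ {z | dist (φ z) (hc x hx).choose < δ / 2} := (hc x hx).choose_spec.2
    rw [hxy] at h1
    have h2 := (hc y hy).choose_spec.2
    rw [map_sub, ← dist_eq_norm]
    have h3 := dist_triangle_right (φ x) (φ y) (hc y hy).choose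
    have h4 : dist (φ x) (hc y hy).choose < δ / 2 := h1
    linarith

theorem natCast_mul_prod_padicNorm {n : ℕ} (hn : n ≠ 0) {T : Finset ℕ} (hT : ∀ p ∈ T, p.Prime)
    (hnT : n.primeFactors ⊆ T) : (n : ℚ) * ∏ p ∈ T, padicNorm p n = 1 := by
  have h1 : n = ∏ p ∈ T, p ^ n.factorization p := by
    conv_lhs => rw [← Nat.prod_factorization_pow_eq_self hn]
    exact Finsupp.prod_of_support_subset _ (by simpa using hnT) _ (by simp)
  have h2 : ((∏ p ∈ T, p ^ n.factorization p : ℕ) : ℚ) * ∏ p ∈ T, padicNorm p n = 1 := by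
    push_cast
    rw [← Finset.prod_mul_distrib]
    refine Finset.prod_eq_one fun p hp => ?_
    have := Fact.mk (hT p hp)
    have hp0 : (p : ℚ) ≠ 0 := by exact_mod_cast (hT p hp).ne_zero
    rw [padicNorm.eq_zpow_of_nonzero (by exact_mod_cast hn), padicValRat.of_nat,
      Nat.factorization_def n (hT p hp), zpow_neg, zpow_natCast, mul_inv_cancel₀ (by positivity)]
  rw [← h1] at h2
  exact h2

theorem one_le_abs_mul_prod_padicNorm {q : ℚ} (hq : q ≠ 0) {S : Finset ℕ} (hS : ∀ p ∈ S, p.Prime)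
    (h : ∀ p : ℕ, p.Prime → p ∉ S → padicNorm p q ≤ 1) : 1 ≤ |q| * ∏ p ∈ S, padicNorm p q := by
  set T := S ∪ (q.num.natAbs.primeFactors ∪ q.den.primeFactors) with hTdef
  have hT : ∀ p ∈ T, p.Prime := by
    intro p hp
    simp only [hTdef, Finset.mem_union] at hp
    rcases hp with hp | hp | hp
    · exact hS p hp
    · exact Nat.prime_of_mem_primeFactors hp
    · exact Nat.prime_of_mem_primeFactors hp
  have hnum : q.num.natAbs ≠ 0 := by simpa using hq
  have h1 := natCast_mul_prod_padicNorm hnum hT (by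
    rw [hTdef]
    exact Finset.subset_union_left.trans Finset.subset_union_right)
  have h2 := natCast_mul_prod_padicNorm q.den_ne_zero hT (by
    rw [hTdef]
    exact Finset.subset_union_right.trans Finset.subset_union_right)
  have habs : ∀ p ∈ T, padicNorm p (q.num.natAbs : ℚ) = padicNorm p q * padicNorm p q.den := by
    intro p hp
    have := Fact.mk (hT p hp)
    have h3 : padicNorm p (q.num.natAbs : ℚ) = padicNorm p (q.num : ℚ) := by
      rcases Int.natAbs_eq q.num with h | h
      · conv_rhs => rw [h]
        simp
      · conv_rhs => rw [h]
        simp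
    rw [h3, ← padicNorm.mul, Rat.mul_den_eq_num]
  have h3 : |q| * ∏ p ∈ T, padicNorm p q = 1 := by
    rw [Finset.prod_congr rfl habs, Finset.prod_mul_distrib] at h1
    have h4 : (q.num.natAbs : ℚ) = |q| * q.den := by
      rw [Nat.cast_natAbs, Int.cast_abs, ← Rat.mul_den_eq_num, abs_mul, Nat.abs_cast]
    rw [h4] at h1
    calc |q| * ∏ p ∈ T, padicNorm p q
        = |q| * (∏ p ∈ T, padicNorm p q) * (q.den * ∏ p ∈ T, padicNorm p (q.den : ℚ)) := by
          rw [h2, mul_one]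
      _ = 1 := by rw [← h1]; ring
  have hST : S ⊆ T := Finset.subset_union_left
  rw [← Finset.prod_sdiff hST] at h3
  have h4 : ∏ p ∈ T \ S, padicNorm p q ≤ 1 := by
    refine Finset.prod_le_one (fun p _ => padicNorm.nonneg _) fun p hp => ?_
    rw [Finset.mem_sdiff] at hp
    exact h p (hT p hp.1) hp.2
  have h5 : 0 ≤ |q| * ∏ p ∈ S, padicNorm p q :=
    mul_nonneg (abs_nonneg _) (Finset.prod_nonneg fun p _ => padicNorm.nonneg _)
  calc (1 : ℚ) = (∏ p ∈ T \ S, padicNorm p q) * (|q| * ∏ p ∈ S, padicNorm p q) := by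
        rw [← h3]; ring
    _ ≤ 1 * (|q| * ∏ p ∈ S, padicNorm p q) := mul_le_mul_of_nonneg_right h4 h5
    _ = _ := one_mul _

theorem abs_mul_prod_padicNorm_eq_one {q : ℚ} (hq : q ≠ 0) {S : Finset ℕ} (hS : ∀ p ∈ S, p.Prime)
    (h : ∀ p : ℕ, p.Prime → p ∉ S → padicNorm p q = 1) : |q| * ∏ p ∈ S, padicNorm p q = 1 := by
  have h1 := one_le_abs_mul_prod_padicNorm hq hS fun p hp hpS => (h p hp hpS).le
  have h2 := one_le_abs_mul_prod_padicNorm (inv_ne_zero hq) hS fun p hp hpS => by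
    have := Fact.mk hp
    have h3 := padicNorm.mul (p := p) q q⁻¹
    rw [mul_inv_cancel₀ hq, padicNorm.one, h p hp hpS, one_mul] at h3
    exact h3.symm.le
  have h3 : (|q| * ∏ p ∈ S, padicNorm p q) * (|q⁻¹| * ∏ p ∈ S, padicNorm p q⁻¹) = 1 := by
    rw [mul_mul_mul_comm, ← abs_mul, mul_inv_cancel₀ hq, abs_one, one_mul,
      ← Finset.prod_mul_distrib]
    refine Finset.prod_eq_one fun p hp => ?_
    have := Fact.mk (hS p hp)
    rw [← padicNorm.mul, mul_inv_cancel₀ hq, padicNorm.one]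
  nlinarith

theorem padicNorm_den_mul_max (p : ℕ) [Fact p.Prime] (x : ℚ) :
    padicNorm p x.den * max 1 (padicNorm p x) = 1 := by
  rw [mul_max_of_nonneg _ _ (padicNorm.nonneg _), mul_one, ← padicNorm.mul, mul_comm _ x,
    Rat.mul_den_eq_num]
  by_cases h : (p : ℤ) ∣ x.den
  · have h1 : ¬ (p : ℤ) ∣ x.num := by
      intro h2
      have h3 := Nat.dvd_gcd (Int.natAbs_dvd_natAbs.mpr h2) (Int.natCast_dvd_natCast.mp h)
      rw [Int.natAbs_natCast, x.reduced.gcd_eq_one] at h3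
      exact (Fact.out : p.Prime).one_lt.ne' (Nat.dvd_one.mp h3)
    rw [(padicNorm.int_eq_one_iff _).mpr h1]
    exact max_eq_right (by exact_mod_cast padicNorm.of_int x.den)
  · have h2 : padicNorm p ((x.den : ℤ) : ℚ) = 1 := (padicNorm.int_eq_one_iff _).mpr h
    rw [Int.cast_natCast] at h2
    rw [h2]
    exact max_eq_left (padicNorm.of_int _)

open Polynomial in
theorem padicNorm_den_pow_mul_aeval_eq_one {p : ℕ} [Fact p.Prime] {g : ℤ[X]} (hg : g.Monic)
    (hr : 1 ≤ g.natDegree) {x : ℚ} (h : padicNorm p x ≤ 1 → 1 ≤ padicNorm p (aeval x g)) :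
    padicNorm p ((x.den : ℚ) ^ g.natDegree * aeval x g) = 1 := by
  obtain ⟨m, hm⟩ := exists_intCast_eq_den_pow_mul_aeval g le_rfl x
  have hle : padicNorm p ((x.den : ℚ) ^ g.natDegree * aeval x g) ≤ 1 := by
    rw [← hm]
    exact padicNorm.of_int m
  have hmax := padicNorm_den_mul_max p x
  rcases le_or_gt (padicNorm p x) 1 with hx | hx
  · rw [max_eq_left hx, mul_one] at hmax
    refine le_antisymm hle ?_
    rw [padicNorm.mul, IsAbsoluteValue.abv_pow (padicNorm p), hmax, one_pow, one_mul]
    exact h hx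
  · rw [max_eq_right hx.le] at hmax
    obtain ⟨m', hm'⟩ := exists_intCast_eq_den_pow_mul_aeval g.eraseLead
      (N := g.natDegree - 1) (eraseLead_natDegree_le g) x
    have hg' : aeval x g = aeval x g.eraseLead + x ^ g.natDegree := by
      have h1 := congrArg (aeval x) g.eraseLead_add_monomial_natDegree_leadingCoeff
      rw [map_add, aeval_monomial, hg.leadingCoeff, map_one, one_mul] at h1
      exact h1.symm
    have h1 : m = x.num ^ g.natDegree + x.den * m' := by
      have h2 : (m : ℚ) = x.num ^ g.natDegree + x.den * m' := by
        rw [hm, hg', hm', ← Rat.mul_den_eq_num, ← mul_assoc, ← pow_succ', Nat.sub_add_cancel hr]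
        ring
      exact_mod_cast h2
    rw [← hm, padicNorm.int_eq_one_iff]
    intro hpm
    have hpd : (p : ℤ) ∣ x.den := by
      rw [← padicNorm.int_lt_one_iff, Int.cast_natCast]
      by_contra! hcon
      have : 1 < padicNorm p x.den * padicNorm p x := by nlinarith
      linarith
    rw [h1, Int.dvd_add_left (Dvd.dvd.mul_right hpd _)] at hpm
    have hpn := Int.natAbs_dvd_natAbs.mpr ((Nat.prime_iff_prime_int.mp Fact.out).dvd_of_dvd_pow hpm)
    have h3 := Nat.dvd_gcd hpn (Int.natCast_dvd_natCast.mp hpd)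
    rw [x.reduced.gcd_eq_one] at h3
    exact (Fact.out : p.Prime).one_lt.ne' (Nat.dvd_one.mp h3)

open Polynomial in
/-- A `p`-adic Thue-Mahler type statement: a separable polynomial of large degree takes few values
composed of finitely many primes. -/
theorem finite_setOf_padicNorm_aeval (g : ℤ[X]) (hg : g.Monic)
    (hsep : (g.map (Int.castRingHom ℚ)).Separable) (hr : 8 ≤ g.natDegree) (S : Finset ℕ) :
    {x : ℚ | ∀ p : ℕ, p.Prime → p ∉ S → padicNorm p x ≤ 1 →
      1 ≤ padicNorm p (aeval x g)}.Finite := by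
  wlog hS : ∀ p ∈ S, p.Prime generalizing S
  · refine (this (S.filter Nat.Prime) (fun p hp => (Finset.mem_filter.mp hp).2)).subset ?_
    intro x hx p hp hpS
    exact hx p hp fun h => hpS (Finset.mem_filter.mpr ⟨h, hp⟩)
  let v : Option S → AbsoluteValue ℚ ℝ := fun o => o.elim Rat.AbsoluteValue.real
    fun p => @Rat.AbsoluteValue.padic p.1 ⟨hS p.1 p.2⟩
  have hvprod : ∀ q : ℚ, ∏ i, v i q = ((|q| * ∏ p ∈ S, padicNorm p q : ℚ) : ℝ) := by
    intro q
    rw [Fintype.prod_option, ← Finset.prod_coe_sort S, Rat.cast_mul, Rat.cast_prod]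
    congr 1
    exact Rat.AbsoluteValue.real_eq_abs q
  have hroots : {x : ℚ | aeval x g = 0}.Finite := by
    refine (Polynomial.finite_setOfPred_isRoot (p := g.map (Int.castRingHom ℚ)) ?_).subset ?_
    · exact (hg.map _).ne_zero
    · intro x hx
      show (g.map (Int.castRingHom ℚ)).eval x = 0
      rw [eval_map]
      exact hx
  have key := finite_of_prod_absoluteValue_eq_one v ?_ ?_ ?_ g hg hsep hr
    ({x : ℚ | ∀ p : ℕ, p.Prime → p ∉ S → padicNorm p x ≤ 1 →
      1 ≤ padicNorm p (aeval x g)} \ {x : ℚ | aeval x g = 0}) ?_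
  · exact (key.union hroots).subset (by rw [Set.sdiff_union_self]; exact Set.subset_union_left)
  · rintro (_ | p) A δ hδ
    · obtain ⟨col, h1, h2⟩ := exists_finite_coloring (algebraMap ℚ ℝ) A δ hδ
      refine ⟨col, h1, fun x y hx hy hxy => ?_⟩
      have h3 : ∀ z : ℚ, v none z = ‖algebraMap ℚ ℝ z‖ := by
        intro z
        show Rat.AbsoluteValue.real z = _
        rw [Rat.AbsoluteValue.real_eq_abs, Rat.cast_abs, Real.norm_eq_abs]
        rfl
      rw [h3] at hx hy ⊢
      exact h2 x y hx hy hxy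
    · have := Fact.mk (hS p.1 p.2)
      obtain ⟨col, h1, h2⟩ := exists_finite_coloring (algebraMap ℚ ℚ_[p]) A δ hδ
      refine ⟨col, h1, fun x y hx hy hxy => ?_⟩
      have h3 : ∀ z : ℚ, v (some p) z = ‖algebraMap ℚ ℚ_[p] z‖ := by
        intro z
        rw [eq_ratCast (algebraMap ℚ ℚ_[p.1]), Padic.eq_padicNorm]
        rfl
      rw [h3] at hx hy ⊢
      exact h2 x y hx hy hxy
  · intro x
    rw [Fintype.prod_option]
    have h1 : v none x.den * max 1 (v none x) = ratHeight x := by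
      show Rat.AbsoluteValue.real x.den * max 1 (Rat.AbsoluteValue.real x) = _
      rw [Rat.AbsoluteValue.real_eq_abs, Rat.AbsoluteValue.real_eq_abs, ratHeight,
        mul_max_of_nonneg _ _ (by positivity), ← Rat.cast_mul, ← abs_mul, mul_comm _ x,
        Rat.mul_den_eq_num, max_comm]
      simp
    rw [h1, Finset.prod_eq_one, mul_one]
    intro p _
    have := Fact.mk (hS p.1 p.2)
    have h2 := padicNorm_den_mul_max p.1 x
    show ((padicNorm p.1 x.den : ℚ) : ℝ) * max 1 ((padicNorm p.1 x : ℚ) : ℝ) = 1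
    exact_mod_cast h2
  · intro Z hZ
    rw [hvprod]
    have := one_le_abs_mul_prod_padicNorm (q := Z) (by exact_mod_cast hZ) hS fun p hp _ => by
      have := Fact.mk hp
      exact padicNorm.of_int Z
    exact_mod_cast this
  · rintro x ⟨hx, hx0⟩
    rw [hvprod, abs_mul_prod_padicNorm_eq_one _ hS, Rat.cast_one]
    · intro p hp hpS
      have := Fact.mk hp
      exact padicNorm_den_pow_mul_aeval_eq_one hg (by omega) (hx p hp hpS)
    · exact mul_ne_zero (pow_ne_zero _ (by exact_mod_cast x.den_ne_zero)) hx0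

open Polynomial in
theorem exists_ne_zero_forall_coeff_mul_mem_range (g : ℚ[X]) :
    ∃ c : ℕ, c ≠ 0 ∧ ∀ i, ∃ m : ℤ, (m : ℚ) = g.coeff i * c := by
  refine ⟨∏ i ∈ g.support, (g.coeff i).den, Finset.prod_ne_zero_iff.mpr fun i _ => Rat.den_ne_zero _,
    fun i => ?_⟩
  by_cases h : i ∈ g.support
  · refine ⟨(g.coeff i).num * ∏ j ∈ g.support.erase i, ((g.coeff j).den : ℤ), ?_⟩
    rw [← Finset.mul_prod_erase _ _ h]
    push_cast
    rw [← mul_assoc, Rat.mul_den_eq_num]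
  · exact ⟨0, by rw [notMem_support_iff.mp h]; simp⟩

open Polynomial in
theorem scaleRoots_separable {g : ℚ[X]} (h : g.Separable) {c : ℚ} (hc : c ≠ 0) :
    (g.scaleRoots c).Separable := by
  have h1 : g.scaleRoots c = C (c ^ g.natDegree) * g.comp (C c⁻¹ * X) := by
    refine Polynomial.funext fun x => ?_
    have h2 := scaleRoots_eval₂_mul (p := g) (RingHom.id ℚ) (c⁻¹ * x) c
    rw [eval₂_id, eval₂_id, RingHom.id_apply, mul_inv_cancel_left₀ hc] at h2
    simp [h2]
  have h3 : (g.comp (C c⁻¹ * X)).Separable := by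
    rw [separable_def, derivative_comp]
    have h4 := IsCoprime.map h (compRingHom (C c⁻¹ * X))
    simp only [coe_compRingHom_apply] at h4
    refine IsCoprime.mul_right ?_ h4
    simp only [derivative_mul, derivative_C, zero_mul, derivative_X, mul_one, zero_add]
    exact ⟨0, C c, by rw [zero_mul, zero_add, ← C_mul, mul_inv_cancel₀ hc, C_1]⟩
  rw [h1]
  have hu : IsUnit (C (c ^ g.natDegree)) := isUnit_C.mpr (pow_ne_zero _ hc).isUnit
  rw [separable_def, derivative_C_mul]
  exact (isCoprime_mul_unit_left hu _ _).mpr h3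

open Polynomial in
theorem finite_setOf_padicNorm_eval (g : ℚ[X]) (hg : g.Monic) (hsep : g.Separable)
    (hr : 8 ≤ g.natDegree) (S : Finset ℕ) :
    {x : ℚ | ∀ p : ℕ, p.Prime → p ∉ S → padicNorm p x ≤ 1 →
      1 ≤ padicNorm p (g.eval x)}.Finite := by
  obtain ⟨c, hc, hcg⟩ := exists_ne_zero_forall_coeff_mul_mem_range g
  have hc' : (c : ℚ) ≠ 0 := by exact_mod_cast hc
  have hmon : (g.scaleRoots (c : ℚ)).Monic := (monic_scaleRoots_iff _).mpr hg
  have hlift : g.scaleRoots (c : ℚ) ∈ lifts (Int.castRingHom ℚ) := by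
    rw [lifts_iff_coeff_lifts]
    intro i
    rw [coeff_scaleRoots]
    rcases lt_trichotomy i g.natDegree with hi | hi | hi
    · obtain ⟨m, hm⟩ := hcg i
      refine ⟨m * c ^ (g.natDegree - i - 1), ?_⟩
      have : g.natDegree - i = g.natDegree - i - 1 + 1 := by omega
      rw [this, pow_succ']
      simp [hm, mul_assoc]
    · exact ⟨1, by simp [hi, hg.coeff_natDegree]⟩
    · exact ⟨0, by simp [coeff_eq_zero_of_natDegree_lt hi]⟩
  obtain ⟨G, hG, hGdeg, hGmon⟩ := lifts_and_natDegree_eq_and_monic hlift hmon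
  have key := finite_setOf_padicNorm_aeval G hGmon
    (by rw [hG]; exact scaleRoots_separable hsep hc')
    (by rw [hGdeg, natDegree_scaleRoots]; exact hr) (S ∪ c.primeFactors)
  refine (key.preimage ((mul_right_injective₀ hc').injOn)).subset ?_
  intro x hx p hp hpS
  have := Fact.mk hp
  rw [Finset.mem_union, not_or] at hpS
  have h1 : padicNorm p (c : ℚ) = 1 := by
    refine (padicNorm.nat_eq_one_iff c).mpr fun h => hpS.2 ?_
    exact Nat.mem_primeFactors.mpr ⟨hp, h, hc⟩
  have h2 : aeval ((c : ℚ) * x) G = c ^ g.natDegree * g.eval x := by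
    have h3 := scaleRoots_eval₂_mul (p := g) (RingHom.id ℚ) x (c : ℚ)
    rw [eval₂_id, eval₂_id, RingHom.id_apply, ← hG, eval_map] at h3
    exact h3
  rw [padicNorm.mul, h1, one_mul, h2, padicNorm.mul, IsAbsoluteValue.abv_pow (padicNorm p), h1,
    one_pow, one_mul]
  exact hx p hp hpS.1

/-- The value at `(a, b)` of the degree `d` homogenization of `p`. -/
noncomputable def homEval {R : Type*} [CommRing R] (d : ℕ) (p : Polynomial ℤ) (a b : R) : R :=
  ∑ i ∈ Finset.range (d + 1), (p.coeff i : R) * a ^ i * b ^ (d - i)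

theorem map_homEval {R R' : Type*} [CommRing R] [CommRing R'] (ψ : R →+* R') (d : ℕ)
    (p : Polynomial ℤ) (a b : R) : ψ (homEval d p a b) = homEval d p (ψ a) (ψ b) := by
  simp [homEval, map_sum]

theorem homEval_mul {R : Type*} [CommRing R] (d : ℕ) (p : Polynomial ℤ) (c a b : R) :
    homEval d p (c * a) (c * b) = c ^ d * homEval d p a b := by
  rw [homEval, homEval, Finset.mul_sum]
  refine Finset.sum_congr rfl fun i hi => ?_
  have h : c ^ d = c ^ i * c ^ (d - i) := by
    rw [← pow_add, Nat.add_sub_cancel' (Nat.lt_succ_iff.mp (Finset.mem_range.mp hi))]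
  rw [h, mul_pow, mul_pow]
  ring

theorem homEval_one_right {R : Type*} [CommRing R] {d : ℕ} {p : Polynomial ℤ}
    (hp : p.natDegree ≤ d) (a : R) : homEval d p a 1 = Polynomial.aeval a p := by
  rw [Polynomial.aeval_eq_sum_range' (Nat.lt_succ_of_le hp)]
  simp [homEval]

theorem homEval_one_zero {R : Type*} [CommRing R] (d : ℕ) (p : Polynomial ℤ) :
    homEval d p (1 : R) 0 = p.coeff d := by
  rw [homEval, Finset.sum_range_succ, Finset.sum_eq_zero]
  · simp
  · intro i hi
    rw [zero_pow (Nat.sub_ne_zero_of_lt (Finset.mem_range.mp hi)), mul_zero]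

/-- The self-map of `R²` given by the degree `d` homogenizations of `P` and `Q`. -/
noncomputable def homMap {R : Type*} [CommRing R] (d : ℕ) (P Q : Polynomial ℤ) (u : R × R) :
    R × R :=
  (homEval d P u.1 u.2, homEval d Q u.1 u.2)

theorem prodMap_homMap_iterate {R R' : Type*} [CommRing R] [CommRing R'] (ψ : R →+* R') (d : ℕ)
    (P Q : Polynomial ℤ) (k : ℕ) (u : R × R) :
    Prod.map ψ ψ ((homMap d P Q)^[k] u) = (homMap d P Q)^[k] (Prod.map ψ ψ u) := by
  refine Function.Semiconj.iterate_right (f := Prod.map ψ ψ) (fun u => ?_) k u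
  simp [homMap, map_homEval]

/-- The point of the projective line with homogeneous coordinates `u`. -/
noncomputable def toP1 {K : Type*} [Field K] (u : K × K) : Option K :=
  if u.2 = 0 then none else some (u.1 / u.2)

/-- Homogeneous coordinates of a point of the projective line. -/
def ofP1 {K : Type*} [Field K] (y : Option K) : K × K :=
  y.elim (1, 0) fun x => (x, 1)

theorem toP1_ofP1 {K : Type*} [Field K] (y : Option K) : toP1 (ofP1 y) = y := by
  cases y <;> simp [toP1, ofP1]

theorem ofP1_ne_zero {K : Type*} [Field K] (y : Option K) : ofP1 y ≠ 0 := by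
  cases y <;> simp [ofP1, Prod.ext_iff]

theorem toP1_mul {K : Type*} [Field K] {c : K} (hc : c ≠ 0) (u : K × K) :
    toP1 (c * u.1, c * u.2) = toP1 u := by
  by_cases h : u.2 = 0
  · simp [toP1, h]
  · simp [toP1, h, hc, mul_div_mul_left]

theorem exists_eq_mul_ofP1 {K : Type*} [Field K] {u : K × K} (hu : u ≠ 0) :
    ∃ c : K, c ≠ 0 ∧ u = (c * (ofP1 (toP1 u)).1, c * (ofP1 (toP1 u)).2) := by
  by_cases h : u.2 = 0
  · refine ⟨u.1, fun h1 => hu (Prod.ext h1 h), ?_⟩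
    ext <;> simp [toP1, ofP1, h]
  · refine ⟨u.2, h, ?_⟩
    ext <;> simp [toP1, ofP1, h, mul_div_cancel₀]

theorem toP1_eq_toP1_iff {K : Type*} [Field K] {u v : K × K} (hu : u ≠ 0) (hv : v ≠ 0) :
    toP1 u = toP1 v ↔ v.2 * u.1 - v.1 * u.2 = 0 := by
  by_cases h : u.2 = 0 <;> by_cases h' : v.2 = 0
  · simp [toP1, h, h']
  · have h1 : u.1 ≠ 0 := fun h1 => hu (Prod.ext h1 h)
    simp [toP1, h, h', h1]
  · have h1 : v.1 ≠ 0 := fun h1 => hv (Prod.ext h1 h')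
    simp [toP1, h, h', h1]
  · simp only [toP1, h, h', if_false, Option.some.injEq]
    rw [div_eq_div_iff h h', sub_eq_zero, mul_comm v.2]

/-- The self-map of the projective line given by the homogenizations of `P` and `Q`. -/
noncomputable def projMap {K : Type*} [Field K] (d : ℕ) (P Q : Polynomial ℤ) (y : Option K) :
    Option K :=
  toP1 (homMap d P Q (ofP1 y))

theorem projMap_toP1 {K : Type*} [Field K] (d : ℕ) (P Q : Polynomial ℤ) {u : K × K} (hu : u ≠ 0) :
    projMap d P Q (toP1 u) = toP1 (homMap d P Q u) := by
  obtain ⟨c, hc, h⟩ := exists_eq_mul_ofP1 hu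
  conv_rhs => rw [h]
  rw [projMap, ← toP1_mul (pow_ne_zero d hc)]
  simp [homMap, homEval_mul]

/-- The homogenizations of `P` and `Q` have no common zero on the projective line over `K`. -/
def HasGoodReduction (d : ℕ) (P Q : Polynomial ℤ) (K : Type*) [Field K] : Prop :=
  ∀ u : K × K, u ≠ 0 → homMap d P Q u ≠ 0

theorem HasGoodReduction.iterate_ne_zero {d : ℕ} {P Q : Polynomial ℤ} {K : Type*} [Field K]
    (h : HasGoodReduction d P Q K) {u : K × K} (hu : u ≠ 0) (k : ℕ) :
    (homMap d P Q)^[k] u ≠ 0 := by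
  induction k with
  | zero => exact hu
  | succ k ih =>
    rw [Function.iterate_succ_apply']
    exact h _ ih

theorem HasGoodReduction.projMap_iterate_toP1 {d : ℕ} {P Q : Polynomial ℤ} {K : Type*} [Field K]
    (h : HasGoodReduction d P Q K) {u : K × K} (hu : u ≠ 0) (k : ℕ) :
    (projMap d P Q)^[k] (toP1 u) = toP1 ((homMap d P Q)^[k] u) := by
  induction k with
  | zero => rfl
  | succ k ih =>
    rw [Function.iterate_succ_apply', Function.iterate_succ_apply', ih,
      projMap_toP1 _ _ _ (h.iterate_ne_zero hu k)]

theorem hasGoodReduction_of_ne_zero {d : ℕ} {P Q U V : Polynomial ℤ} {r : ℤ}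
    (hP : P.natDegree ≤ d) (hQ : Q.natDegree ≤ d) (hb : U * P + V * Q = Polynomial.C r)
    {K : Type*} [Field K] (hr : (r : K) ≠ 0)
    (hlead : (P.coeff d : K) ≠ 0 ∨ (Q.coeff d : K) ≠ 0) : HasGoodReduction d P Q K := by
  intro u hu h0
  obtain ⟨c, hc, h⟩ := exists_eq_mul_ofP1 hu
  have h1 := congrArg Prod.fst h0
  have h2 := congrArg Prod.snd h0
  rw [h] at h1 h2
  simp only [homMap, homEval_mul, Prod.fst_zero, Prod.snd_zero, mul_eq_zero,
    pow_ne_zero d hc, false_or] at h1 h2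
  cases hy : toP1 u with
  | none =>
    rw [hy] at h1 h2
    simp only [ofP1, Option.elim, homEval_one_zero] at h1 h2
    tauto
  | some x =>
    rw [hy] at h1 h2
    simp only [ofP1, Option.elim, homEval_one_right hP, homEval_one_right hQ] at h1 h2
    have h3 := congrArg (Polynomial.aeval x) hb
    rw [map_add, map_mul, map_mul, h1, h2, mul_zero, mul_zero, add_zero, Polynomial.aeval_C] at h3
    exact hr h3.symm

/-- The polynomial whose roots are the finite points sent by the `k`-th iterate to the point with
homogeneous coordinates `(s : t)`. -/
noncomputable def preimagePoly (d : ℕ) (P Q : Polynomial ℤ) (s t : ℤ) (k : ℕ) : Polynomial ℤ :=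
  Polynomial.C t * ((homMap d P Q)^[k] (Polynomial.X, 1)).1 -
    Polynomial.C s * ((homMap d P Q)^[k] (Polynomial.X, 1)).2

theorem HasGoodReduction.aeval_preimagePoly_eq_zero_iff {d : ℕ} {P Q : Polynomial ℤ} {K : Type*}
    [Field K] (h : HasGoodReduction d P Q K) {s t : ℤ} (hst : ((s : K), (t : K)) ≠ 0) (k : ℕ)
    (x : K) : Polynomial.aeval x (preimagePoly d P Q s t k) = 0 ↔
      (projMap d P Q)^[k] (some x) = toP1 ((s : K), (t : K)) := by
  have h1 := prodMap_homMap_iterate (Polynomial.aeval (R := ℤ) x).toRingHom d P Q k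
    (Polynomial.X, 1)
  have hx : Prod.map (Polynomial.aeval (R := ℤ) x).toRingHom (Polynomial.aeval (R := ℤ) x).toRingHom
      ((Polynomial.X : Polynomial ℤ), (1 : Polynomial ℤ)) = ofP1 (some x) := by
    simp [ofP1]
  rw [hx] at h1
  have h2 := h.projMap_iterate_toP1 (ofP1_ne_zero (some x)) k
  rw [toP1_ofP1] at h2
  rw [h2, toP1_eq_toP1_iff (h.iterate_ne_zero (ofP1_ne_zero _) k) hst, ← h1]
  simp [preimagePoly]

open Polynomial in
theorem num_denom_ratFuncQC (f : RatFunc ℚ) :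
    (ratFuncQC f).num = f.num.map (algebraMap ℚ ℂ) ∧
      (ratFuncQC f).denom = f.denom.map (algebraMap ℚ ℂ) := by
  have hm : (f.denom.map (algebraMap ℚ ℂ)).Monic := f.monic_denom.map _
  have hc : IsCoprime (f.num.map (algebraMap ℚ ℂ)) (f.denom.map (algebraMap ℚ ℂ)) :=
    f.isCoprime_num_denom.map (mapRingHom (algebraMap ℚ ℂ))
  have h := (RatFunc.num_mul_eq_mul_denom_iff (x := ratFuncQC f) hm.ne_zero).mpr rfl
  have hc' := RatFunc.isCoprime_num_denom (ratFuncQC f)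
  have hd : (ratFuncQC f).denom = f.denom.map (algebraMap ℚ ℂ) := by
    refine eq_of_monic_of_associated (RatFunc.monic_denom _) hm (associated_of_dvd_dvd ?_ ?_)
    · exact hc'.symm.dvd_of_dvd_mul_left ⟨f.num.map (algebraMap ℚ ℂ), by rw [h, mul_comm]⟩
    · exact hc.symm.dvd_of_dvd_mul_left ⟨(ratFuncQC f).num, by rw [← h, mul_comm]⟩
  refine ⟨?_, hd⟩
  rw [hd] at h
  exact mul_right_cancel₀ hm.ne_zero h

open Polynomial in
theorem P1map_eq_projMap {K : Type*} [Field K] [CharZero K] (f : RatFunc K) {e : K} (he : e ≠ 0)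
    {P Q : ℤ[X]} (hP : P.map (Int.castRingHom K) = C e * f.num)
    (hQ : Q.map (Int.castRingHom K) = C e * f.denom) :
    P1map f = projMap (max P.natDegree Q.natDegree) P Q := by
  have hinj : Function.Injective (Int.castRingHom K) := (Int.castRingHom K).injective_int
  have hPd : f.num.natDegree = P.natDegree := by
    rw [← natDegree_map_eq_of_injective hinj, hP, natDegree_C_mul he]
  have hQd : f.denom.natDegree = Q.natDegree := by
    rw [← natDegree_map_eq_of_injective hinj, hQ, natDegree_C_mul he]
  have hPc : ∀ i, (P.coeff i : K) = e * f.num.coeff i := fun i => by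
    have := congrArg (fun p => coeff p i) hP
    simpa using this
  have hQc : ∀ i, (Q.coeff i : K) = e * f.denom.coeff i := fun i => by
    have := congrArg (fun p => coeff p i) hQ
    simpa using this
  have hPe : ∀ x : K, aeval x P = e * f.num.eval x := fun x => by
    have := congrArg (eval x) hP
    rw [eval_map, eval_mul, eval_C] at this
    exact this
  have hQe : ∀ x : K, aeval x Q = e * f.denom.eval x := fun x => by
    have := congrArg (eval x) hQ
    rw [eval_map, eval_mul, eval_C] at this
    exact this
  funext y
  cases y with
  | some x =>
    simp only [P1map, projMap, homMap, ofP1, Option.elim, homEval_one_right (le_max_left _ _),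
      homEval_one_right (le_max_right _ _), hPe, hQe]
    rw [toP1_mul he (f.num.eval x, f.denom.eval x), toP1]
  | none =>
    simp only [projMap, homMap, ofP1, Option.elim, homEval_one_zero, hPc, hQc]
    rw [toP1_mul he (f.num.coeff _, f.denom.coeff _)]
    simp only [P1map, toP1]
    rw [hPd, hQd]
    split_ifs with h1 h2 h3 h4 h5
    · rfl
    · rw [max_eq_left h1.le] at h2
      exact absurd (coeff_eq_zero_of_natDegree_lt (by omega)) h2
    · rw [max_eq_right h3.le, ← hQd, f.monic_denom.coeff_natDegree] at h4
      exact absurd h4 one_ne_zero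
    · rw [max_eq_right h3.le, ← hQd, coeff_eq_zero_of_natDegree_lt (by omega), zero_div]
    · rw [max_eq_right (by omega), ← hQd, f.monic_denom.coeff_natDegree] at h5
      exact absurd h5 one_ne_zero
    · have h6 : P.natDegree = Q.natDegree := by omega
      rw [h6, max_self, leadingCoeff, leadingCoeff, hPd, hQd, h6]

open Polynomial in
theorem exists_map_eq_C_mul (p q : ℚ[X]) : ∃ e : ℕ, e ≠ 0 ∧ ∃ P Q : ℤ[X],
    P.map (Int.castRingHom ℚ) = C (e : ℚ) * p ∧ Q.map (Int.castRingHom ℚ) = C (e : ℚ) * q := by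
  obtain ⟨c, hc, h⟩ := exists_ne_zero_forall_coeff_mul_mem_range p
  obtain ⟨c', hc', h'⟩ := exists_ne_zero_forall_coeff_mul_mem_range q
  have h1 : C ((c * c' : ℕ) : ℚ) * p ∈ lifts (Int.castRingHom ℚ) := by
    rw [lifts_iff_coeff_lifts]
    intro i
    obtain ⟨m, hm⟩ := h i
    refine ⟨m * c', ?_⟩
    rw [coeff_C_mul]
    simp [hm]
    ring
  have h2 : C ((c * c' : ℕ) : ℚ) * q ∈ lifts (Int.castRingHom ℚ) := by
    rw [lifts_iff_coeff_lifts]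
    intro i
    obtain ⟨m, hm⟩ := h' i
    refine ⟨m * c, ?_⟩
    rw [coeff_C_mul]
    simp [hm]
    ring
  obtain ⟨P, hP⟩ := (mem_lifts _).mp h1
  obtain ⟨Q, hQ⟩ := (mem_lifts _).mp h2
  exact ⟨c * c', mul_ne_zero hc hc', P, Q, hP, hQ⟩

open Polynomial in
theorem exists_bezout_int {P Q : ℤ[X]}
    (h : IsCoprime (P.map (Int.castRingHom ℚ)) (Q.map (Int.castRingHom ℚ))) :
    ∃ (U V : ℤ[X]) (r : ℤ), r ≠ 0 ∧ U * P + V * Q = C r := by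
  obtain ⟨u, v, huv⟩ := h
  obtain ⟨e, he, U, V, hU, hV⟩ := exists_map_eq_C_mul u v
  refine ⟨U, V, e, by exact_mod_cast he, map_injective _ (Int.castRingHom ℚ).injective_int ?_⟩
  rw [Polynomial.map_add, Polynomial.map_mul, Polynomial.map_mul, hU, hV, mul_assoc, mul_assoc,
    ← mul_add, huv]
  simp

open Polynomial in
/-- An integral model of a rational function. -/
theorem exists_integral_model (f : RatFunc ℚ) : ∃ (P Q : ℤ[X]) (M : ℕ), M ≠ 0 ∧
    P.natDegree = f.num.natDegree ∧ Q.natDegree = f.denom.natDegree ∧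
    IsCoprime (P.map (Int.castRingHom ℂ)) (Q.map (Int.castRingHom ℂ)) ∧
    P1map f = projMap (max P.natDegree Q.natDegree) P Q ∧
    P1map (ratFuncQC f) = projMap (max P.natDegree Q.natDegree) P Q ∧
    ∀ (K : Type) [Field K], (M : K) ≠ 0 →
      HasGoodReduction (max P.natDegree Q.natDegree) P Q K := by
  obtain ⟨e, he, P, Q, hP, hQ⟩ := exists_map_eq_C_mul f.num f.denom
  have he' : (e : ℚ) ≠ 0 := by exact_mod_cast he
  have hinj : Function.Injective (Int.castRingHom ℚ) := (Int.castRingHom ℚ).injective_int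
  have hPd : P.natDegree = f.num.natDegree := by
    rw [← natDegree_map_eq_of_injective hinj, hP, natDegree_C_mul he']
  have hQd : Q.natDegree = f.denom.natDegree := by
    rw [← natDegree_map_eq_of_injective hinj, hQ, natDegree_C_mul he']
  have hu : IsUnit (C (e : ℚ)) := isUnit_C.mpr he'.isUnit
  have hco : IsCoprime (P.map (Int.castRingHom ℚ)) (Q.map (Int.castRingHom ℚ)) := by
    rw [hP, hQ]
    exact (isCoprime_mul_unit_left hu _ _).mpr f.isCoprime_num_denom
  have hmap : ∀ p : ℤ[X], p.map (Int.castRingHom ℂ) =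
      (p.map (Int.castRingHom ℚ)).map (algebraMap ℚ ℂ) := fun p => by
    rw [Polynomial.map_map]
    congr 1
  obtain ⟨U, V, r, hr, hUV⟩ := exists_bezout_int hco
  obtain ⟨l, hl, hl'⟩ : ∃ l : ℤ, l ≠ 0 ∧ (l = P.coeff (max P.natDegree Q.natDegree) ∨
      l = Q.coeff (max P.natDegree Q.natDegree)) := by
    have hP0 : Q ≠ 0 := by
      rintro rfl
      simp [f.denom_ne_zero, he] at hQ
    rcases le_total P.natDegree Q.natDegree with h | h
    · exact ⟨Q.leadingCoeff, leadingCoeff_ne_zero.mpr hP0, Or.inr (by rw [max_eq_right h]; rfl)⟩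
    · by_cases hP0' : P = 0
      · refine ⟨Q.leadingCoeff, leadingCoeff_ne_zero.mpr hP0, Or.inr ?_⟩
        rw [max_eq_right (by simp [hP0'])]
        rfl
      · exact ⟨P.leadingCoeff, leadingCoeff_ne_zero.mpr hP0', Or.inl (by rw [max_eq_left h]; rfl)⟩
  refine ⟨P, Q, (r * l).natAbs, by simp [hr, hl], hPd, hQd, ?_, P1map_eq_projMap f he' hP hQ, ?_,
    ?_⟩
  · rw [hmap, hmap]
    exact hco.map (mapRingHom (algebraMap ℚ ℂ))
  · refine P1map_eq_projMap _ (e := (e : ℂ)) (by exact_mod_cast he) ?_ ?_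
    · rw [(num_denom_ratFuncQC f).1, hmap, hP]
      simp
    · rw [(num_denom_ratFuncQC f).2, hmap, hQ]
      simp
  · intro K _ hM
    have hM' : ((r * l : ℤ) : K) ≠ 0 := by
      rcases Int.natAbs_eq (r * l) with h | h <;> rw [h] <;> simpa using hM
    rw [Int.cast_mul, mul_ne_zero_iff] at hM'
    refine hasGoodReduction_of_ne_zero (le_max_left _ _) (le_max_right _ _) hUV hM'.1 ?_
    rcases hl' with h | h
    · exact Or.inl (h ▸ hM'.2)
    · exact Or.inr (h ▸ hM'.2)

/-- If almost all points have at least two preimages, then the number of preimages of high order of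
a point grows without bound, provided the point is not exceptional. -/
theorem exists_finset_iterate_eq {Y : Type*} (φ : Y → Y) (hsurj : Function.Surjective φ)
    {V : Set Y} (hVfin : V.Finite) (hV : ∀ c ∉ V, ∃ a b, a ≠ b ∧ φ a = c ∧ φ b = c) (β : Y)
    (hβ : 0 < Function.minimalPeriod φ β → ∃ z ≠ β, φ^[Function.minimalPeriod φ β] z = β)
    (N : ℕ) : ∃ K ≥ Function.minimalPeriod φ β, ∃ s : Finset Y, N ≤ s.card ∧
      ∀ y ∈ s, φ^[K] y = β ∧ ∀ i < K, φ^[i] y ≠ β := by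
  set m := Function.minimalPeriod φ β with hm
  let T : ℕ → Set Y := fun j => {y | φ^[j] y = β ∧ ∀ i < j, φ^[i] y ≠ β}
  have hdisj : ∀ i j y, y ∈ T i → y ∈ T j → i = j := by
    intro i j y hi hj
    rcases lt_trichotomy i j with h | h | h
    · exact absurd hi.1 (hj.2 i h)
    · exact h
    · exact absurd hj.1 (hi.2 j h)
  have hper : ∀ i, 0 < i → φ^[i] β = β → 0 < m ∧ m ≤ i := by
    intro i hi h
    have h1 : Function.IsPeriodicPt φ i β := h
    exact ⟨h1.minimalPeriod_pos hi, h1.minimalPeriod_le hi⟩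
  have hstep : ∀ j ≥ m, ∀ y, φ y ∈ T j → y ∈ T (j + 1) := by
    rintro j hj y ⟨h1, h2⟩
    refine ⟨h1, fun i hi h => ?_⟩
    cases i with
    | succ i => exact h2 i (by omega) h
    | zero =>
      rw [Function.iterate_zero, id] at h
      rw [h] at h1 h2
      obtain ⟨h3, h4⟩ := hper (j + 1) j.succ_pos h1
      refine h2 (m - 1) (by omega) ?_
      rw [← Function.iterate_succ_apply, Nat.succ_eq_add_one, Nat.sub_add_cancel h3]
      exact Function.iterate_minimalPeriod
  have hbase : (T m).Nonempty := by
    rcases Nat.eq_zero_or_pos m with h | h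
    · exact ⟨β, by simp [T, h]⟩
    · obtain ⟨z, hz, hz'⟩ := hβ h
      refine ⟨z, hz', fun i hi hi' => ?_⟩
      have h1 : φ^[m - i] β = β := by
        rw [← hi', ← Function.iterate_add_apply, Nat.sub_add_cancel hi.le]
        rw [hi', hz']
      have h2 := (hper (m - i) (by omega) h1).2
      have h3 : i = 0 := by omega
      rw [h3] at hi'
      exact hz hi'
  have hne : ∀ j, (T (m + j)).Nonempty := by
    intro j
    induction j with
    | zero => exact hbase
    | succ j ih =>
      obtain ⟨y, hy⟩ := ih
      obtain ⟨y', rfl⟩ := hsurj y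
      exact ⟨y', hstep (m + j) (Nat.le_add_right _ _) _ hy⟩
  obtain ⟨j₀, hj₀⟩ : ∃ j₀, ∀ j ≥ j₀, ∀ y ∈ T j, y ∉ V := by
    have h1 : {j | ∃ y ∈ V, y ∈ T j}.Finite := by
      refine (hVfin.biUnion (t := fun y => {j | y ∈ T j}) fun y _ =>
        Set.Subsingleton.finite fun i hi j hj => hdisj i j y hi hj).subset ?_
      rintro j ⟨y, hy, hj⟩
      exact Set.mem_biUnion hy hj
    obtain ⟨b, hb⟩ := h1.bddAbove
    refine ⟨b + 1, fun j hj y hy hyV => ?_⟩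
    have := hb ⟨y, hyV, hy⟩
    omega
  have hcard : ∀ i, ∃ s : Finset Y, 2 ^ i ≤ s.card ∧ ∀ y ∈ s, y ∈ T (m + j₀ + i) := by
    intro i
    induction i with
    | zero =>
      obtain ⟨y, hy⟩ := hne j₀
      exact ⟨{y}, by simp, by simpa using hy⟩
    | succ i ih =>
      obtain ⟨s, hs, hsT⟩ := ih
      have hex : ∀ c : s, ∃ a b, a ≠ b ∧ φ a = c ∧ φ b = c := fun c =>
        hV c (hj₀ _ (by omega) _ (hsT c c.2))
      choose a b hab ha hb using hex
      refine ⟨Finset.univ.image a ∪ Finset.univ.image b, ?_, ?_⟩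
      · rw [Finset.card_union_of_disjoint, Finset.card_image_of_injective,
          Finset.card_image_of_injective, Finset.card_univ, Fintype.card_coe, pow_succ]
        · omega
        · intro c c' h
          exact Subtype.ext (by rw [← hb c, ← hb c', h])
        · intro c c' h
          exact Subtype.ext (by rw [← ha c, ← ha c', h])
        · rw [Finset.disjoint_left]
          intro y hy hy'
          obtain ⟨c, -, rfl⟩ := Finset.mem_image.mp hy
          obtain ⟨c', -, h⟩ := Finset.mem_image.mp hy'
          have h1 : c = c' := Subtype.ext (by rw [← ha c, ← hb c', h])
          exact hab c (by rw [h1, h, ← h1])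
      · intro y hy
        rw [Finset.mem_union, Finset.mem_image, Finset.mem_image] at hy
        rw [← add_assoc]
        refine hstep _ (by omega) _ ?_
        rcases hy with ⟨c, -, rfl⟩ | ⟨c, -, rfl⟩
        · rw [ha]
          exact hsT c c.2
        · rw [hb]
          exact hsT c c.2
  obtain ⟨s, hs, hsT⟩ := hcard N
  exact ⟨m + j₀ + N, by omega, s, Nat.lt_two_pow_self.le.trans hs, hsT⟩

open Polynomial in
theorem projMap_eq_iff {K : Type*} [Field K] {d : ℕ} {P Q : ℤ[X]} (hgood : HasGoodReduction d P Q K)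
    (y c : Option K) : projMap d P Q y = c ↔
      (ofP1 c).2 * homEval d P (ofP1 y).1 (ofP1 y).2 -
        (ofP1 c).1 * homEval d Q (ofP1 y).1 (ofP1 y).2 = 0 := by
  conv_lhs => rw [← toP1_ofP1 c]
  exact toP1_eq_toP1_iff (hgood _ (ofP1_ne_zero y)) (ofP1_ne_zero c)

open Polynomial in
theorem projMap_preimages {d : ℕ} (hd : 2 ≤ d) {P Q : ℤ[X]} (hP : P.natDegree ≤ d)
    (hQ : Q.natDegree ≤ d) (hdeg : 2 ≤ max P.natDegree Q.natDegree)
    (hco : IsCoprime (P.map (Int.castRingHom ℂ)) (Q.map (Int.castRingHom ℂ)))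
    (hgood : HasGoodReduction d P Q ℂ) :
    Function.Surjective (projMap (K := ℂ) d P Q) ∧ ∃ V : Set (Option ℂ), V.Finite ∧
      ∀ c ∉ V, ∃ a b, a ≠ b ∧ projMap d P Q a = c ∧ projMap d P Q b = c := by
  set p := P.map (Int.castRingHom ℂ) with hp
  set q := Q.map (Int.castRingHom ℂ) with hq
  have hinj : Function.Injective (Int.castRingHom ℂ) := (Int.castRingHom ℂ).injective_int
  have hpe : ∀ x : ℂ, aeval x P = p.eval x := fun x => (eval_map _ _).symm
  have hqe : ∀ x : ℂ, aeval x Q = q.eval x := fun x => (eval_map _ _).symm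
  let F : Option ℂ → ℂ[X] := fun c => C (ofP1 c).2 * p - C (ofP1 c).1 * q
  have hfin : ∀ (x : ℂ) c, projMap d P Q (some x) = c ↔ (F c).eval x = 0 := by
    intro x c
    rw [projMap_eq_iff hgood]
    simp [ofP1, F, homEval_one_right hP, homEval_one_right hQ, hpe, hqe]
  have hinf : ∀ c, projMap d P Q none = c ↔ (F c).coeff d = 0 := by
    intro c
    rw [projMap_eq_iff hgood]
    simp [ofP1, F, homEval_one_zero, hp, hq]
  have hFdeg : ∀ c, projMap d P Q none ≠ c → (F c).natDegree = d := by
    intro c hc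
    refine le_antisymm ?_ (le_natDegree_of_ne_zero fun h => hc ((hinf c).mpr h))
    refine (natDegree_sub_le _ _).trans (max_le ?_ ?_)
    · exact (natDegree_C_mul_le _ _).trans ((natDegree_map_le).trans hP)
    · exact (natDegree_C_mul_le _ _).trans ((natDegree_map_le).trans hQ)
  refine ⟨fun c => ?_, insert (projMap d P Q none)
    ((fun x => projMap d P Q (some x)) '' {x | (wronskian p q).eval x = 0}), ?_, ?_⟩
  · by_cases h : projMap d P Q none = c
    · exact ⟨none, h⟩
    · obtain ⟨x, hx⟩ := IsAlgClosed.exists_root (F c) (fun h0 => by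
        have h1 := hFdeg c h
        have h2 : (F c).natDegree = 0 := natDegree_eq_of_degree_eq_some h0
        omega)
      exact ⟨some x, (hfin x c).mpr hx⟩
  · refine (Set.Finite.image _ ?_).insert _
    refine finite_setOfPred_isRoot fun h => ?_
    obtain ⟨h1, h2⟩ := hco.wronskian_eq_zero_iff.mp h
    have h3 := derivative_eq_zero.mp h1
    have h4 := derivative_eq_zero.mp h2
    rw [hp, natDegree_map_eq_of_injective hinj] at h3
    rw [hq, natDegree_map_eq_of_injective hinj] at h4
    omega
  · intro c hc
    simp only [Set.mem_insert_iff, not_or] at hc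
    obtain ⟨hc1, hc2⟩ := hc
    have hdegF := hFdeg c (Ne.symm hc1)
    have hF0 : F c ≠ 0 := by
      intro h
      rw [h, natDegree_zero] at hdegF
      omega
    have hsep : (F c).Separable := by
      rw [separable_def, isCoprime_iff_aeval_ne_zero_of_isAlgClosed ℂ ℂ]
      intro x
      by_contra! hx
      rw [coe_aeval_eq_eval] at hx
      refine hc2 ⟨x, ?_, (hfin x c).mpr hx.1⟩
      have h1 : (ofP1 c).2 * p.eval x - (ofP1 c).1 * q.eval x = 0 := by
        simpa [F] using hx.1
      have h2 : (ofP1 c).2 * (derivative p).eval x - (ofP1 c).1 * (derivative q).eval x = 0 := by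
        simpa [F] using hx.2
      show (wronskian p q).eval x = 0
      rw [wronskian, eval_sub, eval_mul, eval_mul]
      by_contra hw
      refine ofP1_ne_zero c (Prod.ext ?_ ?_)
      · refine (mul_eq_zero.mp ?_).resolve_right hw
        linear_combination (derivative p).eval x * h1 - p.eval x * h2
      · refine (mul_eq_zero.mp ?_).resolve_right hw
        linear_combination (derivative q).eval x * h1 - q.eval x * h2
    have hcard := card_rootSet_eq_natDegree (K := ℂ) hsep (IsAlgClosed.splits _)
    rw [hdegF] at hcard
    obtain ⟨a, b, hab⟩ := Fintype.one_lt_card_iff.mp (show 1 < Fintype.card ((F c).rootSet ℂ) by omega)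
    have hroot : ∀ a : (F c).rootSet ℂ, projMap d P Q (some a.1) = c := fun a =>
      (hfin _ _).mpr (by simpa using (mem_rootSet.mp a.2).2)
    exact ⟨some a.1, some b.1, fun h => hab (Subtype.ext (Option.some_injective _ h)), hroot a,
      hroot b⟩

open Polynomial in
theorem exists_separable_dvd_isCoprime {F G : ℚ[X]} (hF : F ≠ 0) (s : Finset ℂ)
    (hs : ∀ z ∈ s, aeval z F = 0 ∧ aeval z G ≠ 0) :
    ∃ g : ℚ[X], g.Monic ∧ g.Separable ∧ s.card ≤ g.natDegree ∧ g ∣ F ∧ IsCoprime g G := by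
  have hint : ∀ z ∈ s, IsIntegral ℚ z := fun z hz =>
    isAlgebraic_iff_isIntegral.mp ⟨F, hF, (hs z hz).1⟩
  set A := s.image (minpoly ℚ) with hA
  have hirr : ∀ q ∈ A, Irreducible q ∧ q.Monic := by
    intro q hq
    obtain ⟨z, hz, rfl⟩ := Finset.mem_image.mp hq
    exact ⟨minpoly.irreducible (hint z hz), minpoly.monic (hint z hz)⟩
  have hcop : ∀ q ∈ A, ∀ q' ∈ A, q ≠ q' → IsCoprime q q' := by
    intro q hq q' hq' hne
    refine (hirr q hq).1.coprime_iff_not_dvd.mpr fun h => hne ?_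
    exact eq_of_monic_of_associated (hirr q hq).2 (hirr q' hq').2
      ((hirr q hq).1.associated_of_dvd (hirr q' hq').1 h)
  have hmon : (∏ q ∈ A, q).Monic := monic_prod_of_monic _ _ fun q hq => (hirr q hq).2
  refine ⟨∏ q ∈ A, q, hmon, ?_, ?_, ?_, ?_⟩
  · exact separable_prod' (fun q hq q' hq' hne => hcop q hq q' hq' hne)
      fun q hq => (hirr q hq).1.separable
  · have h1 : s ⊆ ((∏ q ∈ A, q).aroots ℂ).toFinset := by
      intro z hz
      rw [Multiset.mem_toFinset, mem_aroots]
      refine ⟨hmon.ne_zero, ?_⟩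
      rw [map_prod]
      exact Finset.prod_eq_zero (Finset.mem_image_of_mem _ hz) (minpoly.aeval ℚ z)
    refine (Finset.card_le_card h1).trans ((Multiset.toFinset_card_le _).trans ?_)
    refine (card_roots' _).trans ?_
    rw [natDegree_map]
  · refine Finset.prod_dvd_of_coprime (fun q hq q' hq' hne => hcop q hq q' hq' hne) fun q hq => ?_
    obtain ⟨z, hz, rfl⟩ := Finset.mem_image.mp hq
    exact minpoly.dvd ℚ z (hs z hz).1
  · refine IsCoprime.prod_left fun q hq => (hirr q hq).1.coprime_iff_not_dvd.mpr ?_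
    obtain ⟨z, hz, rfl⟩ := Finset.mem_image.mp hq
    rintro ⟨w, hw⟩
    refine (hs z hz).2 ?_
    rw [hw, map_mul, minpoly.aeval, zero_mul]

theorem map_toP1 {K L : Type*} [Field K] [Field L] (ψ : K →+* L) (u : K × K) :
    (toP1 u).map ψ = toP1 (ψ u.1, ψ u.2) := by
  by_cases h : u.2 = 0 <;> simp [toP1, h]

theorem projMap_map {K L : Type*} [Field K] [Field L] (ψ : K →+* L) (d : ℕ)
    (P Q : Polynomial ℤ) (y : Option K) :
    (projMap d P Q y).map ψ = projMap d P Q (y.map ψ) := by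
  rw [projMap, map_toP1, projMap]
  cases y <;> simp [homMap, ofP1, map_homEval]

open Polynomial in
theorem exists_separable_factor_preimagePoly {d : ℕ} (hd : 2 ≤ d) {P Q : ℤ[X]}
    (hP : P.natDegree ≤ d) (hQ : Q.natDegree ≤ d) (hdeg : 2 ≤ max P.natDegree Q.natDegree)
    (hco : IsCoprime (P.map (Int.castRingHom ℂ)) (Q.map (Int.castRingHom ℂ)))
    (hgood : HasGoodReduction d P Q ℂ) (β : ℚ) {m : ℕ}
    (hm : m = Function.minimalPeriod (projMap d P Q) (some β))
    (hroot : ∀ k : ℕ, 1 ≤ k → ∃ z : ℂ, z ≠ (β : ℂ) ∧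
      (projMap d P Q)^[k] (some z) = some ((β : ℂ))) :
    ∃ K ≥ m, ∃ g : ℚ[X], g.Monic ∧ g.Separable ∧ 8 ≤ g.natDegree ∧
      g ∣ (preimagePoly d P Q β.num β.den K).map (Int.castRingHom ℚ) ∧
      (m ≠ 0 →
        IsCoprime g ((preimagePoly d P Q β.num β.den (K - m)).map (Int.castRingHom ℚ))) := by
  have hconj : Function.Semiconj (Option.map (algebraMap ℚ ℂ)) (projMap (K := ℚ) d P Q)
      (projMap (K := ℂ) d P Q) := fun y => projMap_map (algebraMap ℚ ℂ) d P Q y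
  have hιinj : Function.Injective (Option.map (algebraMap ℚ ℂ)) :=
    Option.map_injective (algebraMap ℚ ℂ).injective
  have hβ : Option.map (algebraMap ℚ ℂ) (some β) = some (β : ℂ) := rfl
  have hmC : Function.minimalPeriod (projMap d P Q) (some (β : ℂ)) = m := by
    rw [hm, Function.minimalPeriod_eq_minimalPeriod_iff]
    intro n
    rw [Function.IsPeriodicPt, Function.IsFixedPt, Function.IsPeriodicPt, Function.IsFixedPt, ← hβ,
      ← (hconj.iterate_right n).eq, hιinj.eq_iff]
  obtain ⟨hsurj, V, hVfin, hV⟩ := projMap_preimages hd hP hQ hdeg hco hgood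
  obtain ⟨K, hK, s, hs, hsK⟩ := exists_finset_iterate_eq _ hsurj hVfin hV (some (β : ℂ)) (by
    intro h
    obtain ⟨z, hz, hz'⟩ := hroot _ h
    exact ⟨some z, fun h => hz (Option.some_injective _ h), hz'⟩) 9
  rw [hmC] at hK
  have hst : (((β.num : ℤ) : ℂ), (((β.den : ℕ) : ℤ) : ℂ)) ≠ 0 := by
    intro h
    have := congrArg Prod.snd h
    simp at this
  have hβP : toP1 (((β.num : ℤ) : ℂ), (((β.den : ℕ) : ℤ) : ℂ)) = some (β : ℂ) := by
    simp only [toP1, Int.cast_natCast, Nat.cast_eq_zero, β.den_ne_zero, if_false]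
    rw [← Rat.cast_def]
  have hae : ∀ (k : ℕ) (z : ℂ),
      aeval z ((preimagePoly d P Q β.num β.den k).map (Int.castRingHom ℚ)) = 0 ↔
        (projMap d P Q)^[k] (some z) = some (β : ℂ) := by
    intro k z
    rw [← hβP, ← hgood.aeval_preimagePoly_eq_zero_iff hst]
    have h1 := aeval_map_algebraMap ℚ z (preimagePoly d P Q β.num β.den k)
    rw [← h1]
    rfl
  have hF : (preimagePoly d P Q β.num β.den K).map (Int.castRingHom ℚ) ≠ 0 := by
    intro h0
    have h1 : ∀ z : ℂ, (projMap d P Q)^[K] (some z) = some (β : ℂ) := fun z =>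
      (hae K z).mp (by rw [h0, map_zero])
    obtain ⟨y₁, hy₁⟩ := hsurj.iterate K none
    obtain ⟨y₂, hy₂⟩ := hsurj.iterate K (some ((β : ℂ) + 1))
    cases y₁ with
    | some z =>
      rw [h1] at hy₁
      exact absurd hy₁ (by simp)
    | none =>
      cases y₂ with
      | some z =>
        rw [h1] at hy₂
        exact absurd hy₂ (by simp)
      | none =>
        rw [hy₁] at hy₂
        exact absurd hy₂ (by simp)
  have hcard : 8 ≤ (Finset.eraseNone s).card := by
    have h1 := Finset.card_map (s := Finset.eraseNone s) Function.Embedding.some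
    rw [Finset.map_some_eraseNone] at h1
    have h2 := Finset.pred_card_le_card_erase (s := s) (a := none)
    omega
  obtain ⟨g, hg1, hg2, hg3, hg4, hg5⟩ := exists_separable_dvd_isCoprime
    (G := if m = 0 then 1 else (preimagePoly d P Q β.num β.den (K - m)).map (Int.castRingHom ℚ))
    hF (Finset.eraseNone s) (by
      intro z hz
      rw [Finset.mem_eraseNone] at hz
      refine ⟨(hae K z).mpr (hsK _ hz).1, ?_⟩
      split_ifs with h
      · simp
      · rw [Ne, hae]
        exact (hsK _ hz).2 _ (by omega))
  refine ⟨K, hK, g, hg1, hg2, hcard.trans hg3, hg4, fun h => ?_⟩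
  rw [if_neg h] at hg5
  exact hg5

/-- Coprime integral homogeneous coordinates of a rational point of the projective line. -/
def primCoords (y : Option ℚ) : ℤ × ℤ :=
  y.elim (1, 0) fun x => (x.num, x.den)

theorem isCoprime_primCoords (y : Option ℚ) : IsCoprime (primCoords y).1 (primCoords y).2 := by
  cases y with
  | none => exact isCoprime_one_left
  | some x => exact Rat.isCoprime_num_den x

theorem cast_primCoords_ne_zero (K : Type*) [Field K] (y : Option ℚ) :
    (((primCoords y).1 : K), ((primCoords y).2 : K)) ≠ 0 := by
  intro h
  obtain ⟨a, b, hab⟩ := isCoprime_primCoords y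
  have h1 := congrArg (Int.cast : ℤ → K) hab
  have h2 : ((primCoords y).1 : K) = 0 := congrArg Prod.fst h
  have h3 : ((primCoords y).2 : K) = 0 := congrArg Prod.snd h
  simp [h2, h3] at h1

theorem toP1_cast_primCoords (y : Option ℚ) :
    toP1 (((primCoords y).1 : ℚ), ((primCoords y).2 : ℚ)) = y := by
  cases y with
  | none => simp [primCoords, toP1]
  | some x => simp [primCoords, toP1, Rat.num_div_den]

/-- Reduction modulo `p` on the projective line. -/
noncomputable def reduce (p : ℕ) [Fact p.Prime] (y : Option ℚ) : Option (ZMod p) :=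
  toP1 (((primCoords y).1 : ZMod p), ((primCoords y).2 : ZMod p))

theorem exists_eq_mul_primCoords (w : ℤ × ℤ) :
    ∃ c : ℤ, w.1 = c * (primCoords (toP1 ((w.1 : ℚ), (w.2 : ℚ)))).1 ∧
      w.2 = c * (primCoords (toP1 ((w.1 : ℚ), (w.2 : ℚ)))).2 := by
  by_cases h : w.2 = 0
  · exact ⟨w.1, by simp [toP1, primCoords, h]⟩
  · have h' : (w.2 : ℚ) ≠ 0 := by exact_mod_cast h
    obtain ⟨c, h1, h2⟩ := Rat.num_den_mk h (Rat.divInt_eq_div w.1 w.2).symm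
    refine ⟨c, ?_⟩
    simp only [toP1, h', if_false, primCoords, Option.elim]
    exact ⟨h1, h2⟩

theorem reduce_toP1 {p : ℕ} [Fact p.Prime] {w : ℤ × ℤ}
    (hw : ((w.1 : ZMod p), (w.2 : ZMod p)) ≠ 0) :
    reduce p (toP1 ((w.1 : ℚ), (w.2 : ℚ))) = toP1 ((w.1 : ZMod p), (w.2 : ZMod p)) := by
  obtain ⟨c, h1, h2⟩ := exists_eq_mul_primCoords w
  have hc : (c : ZMod p) ≠ 0 := by
    intro hc
    refine hw (Prod.ext ?_ ?_)
    · rw [h1, Int.cast_mul, hc, zero_mul]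
      rfl
    · rw [h2, Int.cast_mul, hc, zero_mul]
      rfl
  rw [reduce, ← toP1_mul hc, ← Int.cast_mul, ← Int.cast_mul, ← h1, ← h2]

theorem HasGoodReduction.reduce_projMap {d : ℕ} {P Q : Polynomial ℤ} {p : ℕ} [Fact p.Prime]
    (h : HasGoodReduction d P Q (ZMod p)) (y : Option ℚ) :
    reduce p (projMap d P Q y) = projMap d P Q (reduce p y) := by
  have h1 : ∀ (K : Type) [Field K],
      homMap d P Q (((primCoords y).1 : K), ((primCoords y).2 : K)) =
        (((homMap d P Q (primCoords y)).1 : K), ((homMap d P Q (primCoords y)).2 : K)) :=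
    fun K _ => (prodMap_homMap_iterate (Int.castRingHom K) d P Q 1 (primCoords y)).symm
  conv_lhs => rw [← toP1_cast_primCoords y]
  rw [projMap_toP1 _ _ _ (cast_primCoords_ne_zero ℚ y), h1, reduce_toP1, reduce,
    projMap_toP1 _ _ _ (cast_primCoords_ne_zero (ZMod p) y), h1]
  rw [← h1]
  exact h _ (cast_primCoords_ne_zero (ZMod p) y)

theorem HasGoodReduction.reduce_projMap_iterate {d : ℕ} {P Q : Polynomial ℤ} {p : ℕ}
    [Fact p.Prime] (h : HasGoodReduction d P Q (ZMod p)) (k : ℕ) (y : Option ℚ) :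
    reduce p ((projMap d P Q)^[k] y) = (projMap d P Q)^[k] (reduce p y) :=
  Function.Semiconj.iterate_right (fun y => h.reduce_projMap y) k y

theorem reduce_eq_reduce_iff (p : ℕ) [Fact p.Prime] (y y' : Option ℚ) :
    reduce p y = reduce p y' ↔
      (p : ℤ) ∣ (primCoords y').2 * (primCoords y).1 - (primCoords y').1 * (primCoords y).2 := by
  rw [reduce, reduce, toP1_eq_toP1_iff (cast_primCoords_ne_zero _ y) (cast_primCoords_ne_zero _ y'),
    ← ZMod.intCast_zmod_eq_zero_iff_dvd]
  push_cast
  rfl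

theorem exists_forall_reduce_ne {y y' : Option ℚ} (h : y ≠ y') :
    ∃ M : ℕ, M ≠ 0 ∧ ∀ (p : ℕ) [Fact p.Prime], ¬ p ∣ M → reduce p y ≠ reduce p y' := by
  refine ⟨((primCoords y').2 * (primCoords y).1 - (primCoords y').1 * (primCoords y).2).natAbs,
    ?_, ?_⟩
  · rw [Int.natAbs_ne_zero]
    intro h0
    rw [← toP1_cast_primCoords y, ← toP1_cast_primCoords y', Ne,
      toP1_eq_toP1_iff (cast_primCoords_ne_zero _ y) (cast_primCoords_ne_zero _ y')] at h
    refine h ?_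
    have h1 := congrArg (Int.cast : ℤ → ℚ) h0
    push_cast at h1
    exact h1
  · intro p _ hp h1
    rw [reduce_eq_reduce_iff] at h1
    exact hp (Int.natCast_dvd.mp h1)

theorem dvd_num_sub_iff {p : ℕ} [Fact p.Prime] {x β : ℚ} (hβ : ¬ p ∣ β.den) :
    (p : ℤ) ∣ (x - β).num ↔ reduce p (some x) = reduce p (some β) := by
  have hp : Prime (p : ℤ) := Nat.prime_iff_prime_int.mp Fact.out
  have hβ' : ¬ (p : ℤ) ∣ β.den := by exact_mod_cast hβ
  have key : (x - β).num * (x.den * β.den) = (β.den * x.num - β.num * x.den) * (x - β).den := by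
    have h1 : ((x - β).num : ℚ) * (x.den * β.den) =
        (β.den * x.num - β.num * x.den) * (x - β).den := by
      rw [← Rat.mul_den_eq_num, ← Rat.mul_den_eq_num x, ← Rat.mul_den_eq_num β]
      ring
    exact_mod_cast h1
  rw [reduce_eq_reduce_iff]
  show _ ↔ (p : ℤ) ∣ β.den * x.num - β.num * x.den
  constructor
  · intro h
    have h1 := (hp.dvd_or_dvd (key ▸ h.mul_right _)).resolve_right fun h2 =>
      hp.not_isUnit ((Rat.isCoprime_num_den (x - β)).isUnit_of_dvd' h h2)
    exact h1
  · intro h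
    rcases hp.dvd_or_dvd (key ▸ h.mul_right _ : (p : ℤ) ∣ (x - β).num * (x.den * β.den)) with h1 | h1
    · exact h1
    · have h2 := (hp.dvd_or_dvd h1).resolve_right hβ'
      have h3 : (p : ℤ) ∣ β.den * x.num := by
        have := dvd_add h (h2.mul_left β.num)
        rwa [sub_add_cancel] at this
      have h4 := (hp.dvd_or_dvd h3).resolve_left hβ'
      exact absurd ((Rat.isCoprime_num_den x).isUnit_of_dvd' h4 h2) hp.not_isUnit

open Polynomial in
theorem padicNorm_aeval_lt_one_iff {p : ℕ} [Fact p.Prime] (q : ℤ[X]) {x : ℚ}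
    (hx : padicNorm p x ≤ 1) : ∃ t : ZMod p, reduce p (some x) = some t ∧
      (padicNorm p (aeval x q) < 1 ↔ aeval t q = 0) := by
  have hmax := padicNorm_den_mul_max p x
  rw [max_eq_left hx, mul_one] at hmax
  have hpd : ¬ p ∣ x.den := (padicNorm.nat_eq_one_iff x.den).mp hmax
  have hd : (x.den : ZMod p) ≠ 0 := by rwa [Ne, ZMod.natCast_eq_zero_iff]
  refine ⟨x.num / x.den, by simp [reduce, primCoords, toP1, hd], ?_⟩
  have h1 : ((homEval q.natDegree q x.num x.den : ℤ) : ℚ) = x.den ^ q.natDegree * aeval x q := by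
    have h2 := map_homEval (Int.castRingHom ℚ) q.natDegree q x.num x.den
    rw [← homEval_one_right le_rfl, ← homEval_mul, mul_one, mul_comm _ x, Rat.mul_den_eq_num]
    simpa using h2
  have h3 : ((homEval q.natDegree q x.num x.den : ℤ) : ZMod p) =
      x.den ^ q.natDegree * aeval ((x.num : ZMod p) / x.den) q := by
    have h2 := map_homEval (Int.castRingHom (ZMod p)) q.natDegree q x.num x.den
    rw [← homEval_one_right le_rfl, ← homEval_mul, mul_one, mul_div_cancel₀ _ hd]
    simpa using h2
  have h4 : padicNorm p (aeval x q) = padicNorm p (homEval q.natDegree q x.num x.den : ℤ) := by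
    rw [h1, padicNorm.mul, IsAbsoluteValue.abv_pow (padicNorm p), hmax, one_pow, one_mul]
  rw [h4, padicNorm.int_lt_one_iff, ← ZMod.intCast_zmod_eq_zero_iff_dvd, h3,
    mul_eq_zero_iff_left (pow_ne_zero _ hd)]

open Polynomial in
theorem exists_padicNorm_eval_le_one (q : ℚ[X]) : ∃ M : ℕ, M ≠ 0 ∧
    ∀ (p : ℕ) [Fact p.Prime], ¬ p ∣ M → ∀ x, padicNorm p x ≤ 1 → padicNorm p (q.eval x) ≤ 1 := by
  obtain ⟨M, hM, h⟩ := exists_ne_zero_forall_coeff_mul_mem_range q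
  refine ⟨M, hM, fun p _ hp x hx => ?_⟩
  have hM1 : padicNorm p (M : ℚ) = 1 := (padicNorm.nat_eq_one_iff M).mpr hp
  rw [eval_eq_sum_range]
  refine padicNorm.sum_le' (fun i _ => ?_) zero_le_one
  obtain ⟨m, hm⟩ := h i
  have h1 : padicNorm p (q.coeff i) ≤ 1 := by
    have h2 := padicNorm.of_int (p := p) m
    rwa [hm, padicNorm.mul, hM1, mul_one] at h2
  rw [padicNorm.mul, IsAbsoluteValue.abv_pow (padicNorm p)]
  exact mul_le_one₀ h1 (pow_nonneg (padicNorm.nonneg _) _) (pow_le_one₀ (padicNorm.nonneg _) hx)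

theorem injective_iterate_of_infinite {Y : Type*} {φ : Y → Y} {y : Y}
    (h : {z | ∃ n : ℕ, φ^[n] y = z}.Infinite) : Function.Injective fun n => φ^[n] y := by
  have key : ∀ a b, a < b → φ^[a] y ≠ φ^[b] y := by
    intro a b hab heq
    refine h (((Finset.range b).image fun n => φ^[n] y).finite_toSet.subset ?_)
    rintro _ ⟨n, rfl⟩
    rw [Finset.mem_coe]
    induction n using Nat.strong_induction_on with
    | _ n ih =>
      rcases lt_or_ge n b with hn | hn
      · exact Finset.mem_image_of_mem _ (Finset.mem_range.mpr hn)
      · have h1 : φ^[n] y = φ^[n - b + a] y := by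
          conv_lhs => rw [← Nat.sub_add_cancel hn]
          rw [Function.iterate_add_apply, Function.iterate_add_apply, heq]
        rw [h1]
        exact ih _ (by omega)
  intro a b hab
  rcases lt_trichotomy a b with h1 | h1 | h1
  · exact absurd hab (key a b h1)
  · exact h1
  · exact absurd hab.symm (key b a h1)

/-- Two points of a finite orbit stay distinct modulo almost all primes. -/
theorem exists_forall_reduce_ne_of_finite {s : Set (Option ℚ)} (hs : s.Finite) (y : Option ℚ) :
    ∃ M : ℕ, M ≠ 0 ∧ ∀ (p : ℕ) [Fact p.Prime], ¬ p ∣ M → ∀ z ∈ s,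
      reduce p z = reduce p y → z = y := by
  have hex : ∀ z : Option ℚ, ∃ M : ℕ, M ≠ 0 ∧ ∀ (p : ℕ) [Fact p.Prime], ¬ p ∣ M →
      reduce p z = reduce p y → z = y := by
    intro z
    by_cases hzy : z = y
    · exact ⟨1, one_ne_zero, fun _ _ _ _ => hzy⟩
    · obtain ⟨M, hM, h⟩ := exists_forall_reduce_ne hzy
      exact ⟨M, hM, fun p _ hp h1 => absurd h1 (h p hp)⟩
  choose M hM h using hex
  refine ⟨∏ z ∈ hs.toFinset, M z, Finset.prod_ne_zero_iff.mpr fun z _ => hM z, ?_⟩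
  intro p _ hp z hz
  exact h z p fun h1 => hp (h1.trans (Finset.dvd_prod_of_mem M (hs.mem_toFinset.mpr hz)))

open Polynomial in
theorem exists_padicNorm_aeval_lt_one_of_dvd {g : ℚ[X]} {F : ℤ[X]}
    (h : g ∣ F.map (Int.castRingHom ℚ)) : ∃ M : ℕ, M ≠ 0 ∧ ∀ (p : ℕ) [Fact p.Prime], ¬ p ∣ M →
      ∀ x, padicNorm p x ≤ 1 → padicNorm p (g.eval x) < 1 → padicNorm p (aeval x F) < 1 := by
  obtain ⟨q, hq⟩ := h
  obtain ⟨M, hM, hMq⟩ := exists_padicNorm_eval_le_one q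
  refine ⟨M, hM, fun p _ hp x hx hg => ?_⟩
  have h1 : aeval x F = g.eval x * q.eval x := by
    rw [← eval_mul, ← hq, eval_map]
    rfl
  rw [h1, padicNorm.mul]
  exact (mul_le_of_le_one_right (padicNorm.nonneg _) (hMq p hp x hx)).trans_lt hg

open Polynomial in
theorem exists_one_le_padicNorm_aeval_of_isCoprime {g : ℚ[X]} {F : ℤ[X]}
    (h : IsCoprime g (F.map (Int.castRingHom ℚ))) : ∃ M : ℕ, M ≠ 0 ∧
      ∀ (p : ℕ) [Fact p.Prime], ¬ p ∣ M → ∀ x, padicNorm p x ≤ 1 → padicNorm p (g.eval x) < 1 →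
        1 ≤ padicNorm p (aeval x F) := by
  obtain ⟨u, v, huv⟩ := h
  obtain ⟨M, hM, hMu⟩ := exists_padicNorm_eval_le_one u
  obtain ⟨M', hM', hMv⟩ := exists_padicNorm_eval_le_one v
  refine ⟨M * M', mul_ne_zero hM hM', fun p _ hp x hx hg => ?_⟩
  have h1 : u.eval x * g.eval x + v.eval x * aeval x F = 1 := by
    have := congrArg (eval x) huv
    rw [eval_add, eval_mul, eval_mul, eval_map, eval_one] at this
    exact this
  by_contra! hF
  have h2 : padicNorm p (u.eval x * g.eval x) < 1 := by
    rw [padicNorm.mul]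
    exact (mul_le_of_le_one_left (padicNorm.nonneg _)
      (hMu p (fun h => hp (h.mul_right _)) x hx)).trans_lt hg
  have h3 : padicNorm p (v.eval x * aeval x F) < 1 := by
    rw [padicNorm.mul]
    exact (mul_le_of_le_one_left (padicNorm.nonneg _)
      (hMv p (fun h => hp (h.mul_left _)) x hx)).trans_lt hF
  have h4 := (padicNorm.nonarchimedean (p := p) (q := u.eval x * g.eval x)
    (r := v.eval x * aeval x F)).trans_lt (max_lt h2 h3)
  rw [h1, padicNorm.one] at h4
  exact lt_irrefl _ h4

/-- Ingram–Silverman: let f ∈ ℚ(x) have degree ≥ 2, let α ∈ ℚ be a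
wandering point for f and β ∈ ℚ a preperiodic point for f (as a self-map of P¹(ℚ)), and
suppose that for every k ≥ 1 the equation f^k(z) = β has a complex solution z ≠ β. Let
a_n be the numerator of f^n(α) − β. Then the Zsigmondy set is finite: for all but
finitely many n ≥ 1 with a_n ≠ 0 there is a prime dividing a_n but no earlier nonzero
term a_k (1 ≤ k < n). -/
theorem ingram_silverman_zsigmondy
    (f : RatFunc ℚ) (hdeg : 2 ≤ max f.num.natDegree f.denom.natDegree)
    (α β : ℚ)
    (hα : {Q : Option ℚ | ∃ n : ℕ, (P1map f)^[n] (some α) = Q}.Infinite)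
    (hβ : {Q : Option ℚ | ∃ n : ℕ, (P1map f)^[n] (some β) = Q}.Finite)
    (hroot : ∀ k : ℕ, 1 ≤ k → ∃ z : ℂ, z ≠ (β : ℂ) ∧
      (P1map (ratFuncQC f))^[k] (some z) = some ((β : ℂ))) :
    {n : ℕ | 1 ≤ n ∧ numSeq f α β n ≠ 0 ∧
      ¬ ∃ p : ℕ, p.Prime ∧ (p : ℤ) ∣ numSeq f α β n ∧
        ∀ k : ℕ, 1 ≤ k → k < n → numSeq f α β k ≠ 0 →
          ¬ (p : ℤ) ∣ numSeq f α β k}.Finite := by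
  obtain ⟨P, Q, M₁, hM₁, hP, hQ, hco, hφ, hφC, hgood⟩ := exists_integral_model f
  rw [← hP, ← hQ] at hdeg
  rw [hφC] at hroot
  set d := max P.natDegree Q.natDegree with hd
  obtain ⟨m, hm⟩ : ∃ m, m = Function.minimalPeriod (P1map f) (some β) := ⟨_, rfl⟩
  obtain ⟨K, hK, g, hg1, hg2, hg3, hg4, hg5⟩ := exists_separable_factor_preimagePoly hdeg
    (le_max_left _ _) (le_max_right _ _) hdeg hco (hgood ℂ (by exact_mod_cast hM₁)) β
    (hm.trans (by rw [hφ])) hroot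
  obtain ⟨M₂, hM₂, horb⟩ := exists_forall_reduce_ne_of_finite hβ (some β)
  obtain ⟨M₃, hM₃, hroot'⟩ := exists_padicNorm_aeval_lt_one_of_dvd hg4
  obtain ⟨M₄, hM₄, hnroot⟩ : ∃ M : ℕ, M ≠ 0 ∧ ∀ (p : ℕ) [Fact p.Prime], ¬ p ∣ M → m ≠ 0 →
      ∀ x, padicNorm p x ≤ 1 → padicNorm p (g.eval x) < 1 →
        1 ≤ padicNorm p (Polynomial.aeval x (preimagePoly d P Q β.num β.den (K - m))) := by
    by_cases h : m = 0
    · exact ⟨1, one_ne_zero, fun _ _ _ h1 => absurd h h1⟩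
    · obtain ⟨M, hM, h1⟩ := exists_one_le_padicNorm_aeval_of_isCoprime (hg5 h)
      exact ⟨M, hM, fun p _ hp _ => h1 p hp⟩
  set S := (M₁ * M₂ * M₃ * M₄ * β.den).primeFactors with hS
  have hfin := finite_setOf_padicNorm_eval g hg1 hg2 hg3 S
  set E := {x : ℚ | ∀ p : ℕ, p.Prime → p ∉ S → padicNorm p x ≤ 1 →
      1 ≤ padicNorm p (g.eval x)} with hE
  have hinj := injective_iterate_of_infinite hα
  refine ((Set.finite_lt_nat K).union ((((hfin.image some).insert none).preimage
    hinj.injOn).image (· + K))).subset ?_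
  rintro n ⟨-, hn0, hn⟩
  rcases lt_or_ge n K with hnK | hnK
  · exact Or.inl hnK
  refine Or.inr ⟨n - K, ?_, Nat.sub_add_cancel hnK⟩
  rw [Set.mem_preimage]
  cases hx : (P1map f)^[n - K] (some α) with
  | none => exact Set.mem_insert _ _
  | some x =>
  refine Set.mem_insert_of_mem _ (Set.mem_image_of_mem _ ?_)
  intro p hp hpS hpx
  have := Fact.mk hp
  have hpM : ¬ p ∣ M₁ * M₂ * M₃ * M₄ * β.den := fun h =>
    hpS (Nat.mem_primeFactors.mpr ⟨hp, h, by simp [hM₁, hM₂, hM₃, hM₄]⟩)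
  simp only [hp.dvd_mul, not_or] at hpM
  obtain ⟨⟨⟨⟨hp1, hp2⟩, hp3⟩, hp4⟩, hp5⟩ := hpM
  have hgoodp := hgood (ZMod p) (by rwa [Ne, ZMod.natCast_eq_zero_iff])
  have hred : ∀ k y, reduce p ((P1map f)^[k] y) = (projMap d P Q)^[k] (reduce p y) := by
    rw [hφ]
    exact hgoodp.reduce_projMap_iterate
  have hnum : ∀ k, numSeq f α β k ≠ 0 → ((p : ℤ) ∣ numSeq f α β k ↔
      reduce p ((P1map f)^[k] (some α)) = reduce p (some β)) := by
    intro k hk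
    rw [numSeq] at hk ⊢
    cases hy : (P1map f)^[k] (some α) with
    | none =>
      rw [hy] at hk
      exact absurd rfl hk
    | some y => exact dvd_num_sub_iff hp5
  have hiff : ∀ k, padicNorm p (Polynomial.aeval x (preimagePoly d P Q β.num β.den k)) < 1 ↔
      reduce p ((P1map f)^[k] (some x)) = reduce p (some β) := by
    intro k
    obtain ⟨t, ht, h1⟩ := padicNorm_aeval_lt_one_iff (preimagePoly d P Q β.num β.den k) hpx
    rw [h1, hred, ht]
    exact hgoodp.aeval_preimagePoly_eq_zero_iff (cast_primCoords_ne_zero _ (some β)) k t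
  by_contra! hlt
  have hxK : ∀ k ≤ K, (P1map f)^[k] (some x) = (P1map f)^[n - (K - k)] (some α) := by
    intro k hk
    rw [← hx, ← Function.iterate_add_apply]
    congr 1
    omega
  have hpn : reduce p ((P1map f)^[n] (some α)) = reduce p (some β) := by
    have h1 := (hiff K).mp (hroot' p hp3 x hpx hlt)
    rwa [hxK K le_rfl, Nat.sub_self, Nat.sub_zero] at h1
  refine hn ⟨p, hp, (hnum n hn0).mpr hpn, fun k hk hkn hk0 hpk => ?_⟩
  rw [hnum k hk0] at hpk
  have hstep : ∀ i, reduce p ((P1map f)^[i + k] (some α)) =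
      reduce p ((P1map f)^[i] (some β)) := by
    intro i
    rw [Function.iterate_add_apply, hred, hpk, ← hred]
  have hper : Function.IsPeriodicPt (P1map f) (n - k) (some β) := by
    refine horb p hp2 _ ⟨_, rfl⟩ ?_
    rw [← hstep, Nat.sub_add_cancel hkn.le, hpn]
  obtain ⟨j, hj⟩ := Function.isPeriodicPt_iff_minimalPeriod_dvd.mp hper
  rw [← hm] at hj
  have hm0 : m ≠ 0 := by
    rintro rfl
    omega
  have hj0 : j ≠ 0 := by
    rintro rfl
    omega
  have h1 := hstep (m * (j - 1))
  have h2 : (P1map f)^[m * (j - 1)] (some β) = some β :=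
    (hm ▸ Function.isPeriodicPt_minimalPeriod (P1map f) (some β)).mul_const (j - 1)
  have h3 : m * j = m * (j - 1) + m := by
    rw [← Nat.mul_succ, Nat.succ_eq_add_one, Nat.sub_add_cancel (Nat.pos_of_ne_zero hj0)]
  have h4 : m * (j - 1) + k = n - (K - (K - m)) := by omega
  rw [h2, h4, ← hxK (K - m) (Nat.sub_le _ _), ← hiff] at h1
  exact absurd h1 (not_lt.mpr (hnroot p hp4 hm0 x hpx hlt))
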